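/- Let Φ : 𝔗(ℋ) → 𝔗(ℋ') be a quantum operation and Φ̃ its complementary operation. Let 𝒜 be a subset of 𝔗₊(ℋ) such that min{H_Φ(A), H_{Φ̃}(A)} < +∞ for every A ∈ 𝒜. If the quantum entropy is continuous on 𝒜, then the function A ↦ H_Φ(A) − H_{Φ̃}(A) is (finite and) continuous on 𝒜. -/

import Mathlib

open scoped ENNReal NNReal
open Filter Topology Classical
attribute [local instance] Classical.propDecidable

noncomputable section

namespace QIT

section Defs

variable {E F G : Type*}
variable [NormedAddCommGroup E] [InnerProductSpace ℂ E] [CompleteSpace E]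
variable [NormedAddCommGroup F] [InnerProductSpace ℂ F] [CompleteSpace F]
variable [NormedAddCommGroup G] [InnerProductSpace ℂ G] [CompleteSpace G]

/-- The real part of `⟪x, A x⟫`. -/
def qf (A : E →L[ℂ] E) (x : E) : ℝ := (inner ℂ x (A x) : ℂ).re

/-- The trace of a positive operator, as the supremum of finite diagonal sums over
finite orthonormal families.  For positive operators this coincides with the usual
trace (with value `∞` when the operator is not trace class). -/
def traceENN (A : E →L[ℂ] E) : ℝ≥0∞ :=
  ⨆ (n : ℕ) (e : Fin n → E) (_ : Orthonormal ℂ e), ∑ i, ENNReal.ofReal (qf A (e i))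

/-- The trace norm `‖A‖₁`, as the supremum of `∑ |⟪e i, A (f i)⟫|` over pairs of finite
orthonormal families; it is finite exactly on trace-class operators. -/
def traceNorm (A : E →L[ℂ] E) : ℝ≥0∞ :=
  ⨆ (n : ℕ) (e : Fin n → E) (f : Fin n → E) (_ : Orthonormal ℂ e) (_ : Orthonormal ℂ f),
    ∑ i, ENNReal.ofReal ‖(inner ℂ (e i) (A (f i)) : ℂ)‖

/-- `A` is a trace-class operator. -/
def IsTC (A : E →L[ℂ] E) : Prop := traceNorm A ≠ ∞

/-- The cone `𝔗₊(E)` of positive trace-class operators. -/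
def posTC (E : Type*) [NormedAddCommGroup E] [InnerProductSpace ℂ E] [CompleteSpace E] :
    Set (E →L[ℂ] E) := {A | A.IsPositive ∧ IsTC A}

/-- The set `𝔖(E)` of states (density operators). -/
def states (E : Type*) [NormedAddCommGroup E] [InnerProductSpace ℂ E] [CompleteSpace E] :
    Set (E →L[ℂ] E) := {A | A.IsPositive ∧ traceENN A = 1}

/-- The extended classical entropy `H({x_i}) = ∑ η(x_i) − η(∑ x_i)` of a nonnegative
summable family, written in the equivalent homogeneous form `(∑ x) · H({x_i/∑x})`. -/
def clEntropy {ι : Type*} (x : ι → ℝ) : ℝ≥0∞ :=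
  ENNReal.ofReal (∑' i, x i) *
    ∑' i, ENNReal.ofReal (Real.negMulLog (x i / (∑' j, x j)))

/-- An orthonormal subset with dense span (an orthonormal basis, as a set). -/
def IsONB (s : Set E) : Prop :=
  Orthonormal ℂ ((↑) : s → E) ∧ Dense ((Submodule.span ℂ s : Submodule ℂ E) : Set E)

/-- The quantum (von Neumann) entropy `H(A) = Tr η(A) − η(Tr A)` of a positive trace-class
operator, realized as the infimum over all orthonormal bases of the classical entropy of
the diagonal of `A` (the infimum is attained on an eigenbasis of `A`). -/
def qEntropy (A : E →L[ℂ] E) : ℝ≥0∞ :=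
  ⨅ (s : Set E) (_ : IsONB s), clEntropy fun v : s => qf A v

theorem exists_isONB (E : Type*) [NormedAddCommGroup E] [InnerProductSpace ℂ E]
    [CompleteSpace E] : ∃ s : Set E, IsONB s := by
  obtain ⟨w, b, hb⟩ := exists_hilbertBasis ℂ E
  refine ⟨w, ?_, ?_⟩
  · have h := b.orthonormal
    rwa [hb] at h
  · have h := b.dense_span
    rw [hb, Subtype.range_coe] at h
    rwa [Submodule.dense_iff_topologicalClosure_eq_top]

/-- A fixed orthonormal basis (as a set). -/
def stdONB (E : Type*) [NormedAddCommGroup E] [InnerProductSpace ℂ E] [CompleteSpace E] :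
    Set E := (exists_isONB E).choose

/-- The `ℂ`-valued trace, computed in a fixed orthonormal basis; for trace-class
operators it does not depend on the choice of the basis. -/
def traceC (A : E →L[ℂ] E) : ℂ := ∑' v : stdONB E, (inner ℂ (v : E) (A v) : ℂ)

/-- Continuity (including finiteness) of an `ℝ≥0∞`-valued function on a subset of
operators, with respect to the trace-norm distance. -/
def ContOn (f : (E →L[ℂ] E) → ℝ≥0∞) (𝒜 : Set (E →L[ℂ] E)) : Prop :=
  (∀ A ∈ 𝒜, f A ≠ ∞) ∧
  ∀ A ∈ 𝒜, ∀ ε : ℝ, 0 < ε → ∃ δ : ℝ, 0 < δ ∧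
    ∀ B ∈ 𝒜, traceNorm (B - A) < ENNReal.ofReal δ → |(f B).toReal - (f A).toReal| < ε

/-- Continuity of a real-valued function on a subset of operators with respect to the
trace-norm distance. -/
def RContOn (g : (E →L[ℂ] E) → ℝ) (𝒜 : Set (E →L[ℂ] E)) : Prop :=
  ∀ A ∈ 𝒜, ∀ ε : ℝ, 0 < ε → ∃ δ : ℝ, 0 < δ ∧
    ∀ B ∈ 𝒜, traceNorm (B - A) < ENNReal.ofReal δ → |g B - g A| < ε

/-- Boundedness of an `ℝ≥0∞`-valued function on a set. -/
def BddOn (f : (E →L[ℂ] E) → ℝ≥0∞) (𝒜 : Set (E →L[ℂ] E)) : Prop :=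
  ∃ C : ℝ, ∀ A ∈ 𝒜, f A ≤ ENNReal.ofReal C

/-- Convergence of a sequence of operators in the trace norm. -/
def TendstoTN (A : ℕ → (E →L[ℂ] E)) (A₀ : E →L[ℂ] E) : Prop :=
  ∀ ε : ℝ, 0 < ε → ∃ N : ℕ, ∀ n ≥ N, traceNorm (A n - A₀) < ENNReal.ofReal ε

/-- A positive linear map from the trace class of `E` to the trace class of `F`
(the values of `toFun` outside the trace class are irrelevant). -/
structure TraceMap (E F : Type*) [NormedAddCommGroup E] [InnerProductSpace ℂ E]
    [CompleteSpace E] [NormedAddCommGroup F] [InnerProductSpace ℂ F] [CompleteSpace F] where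
  toFun : (E →L[ℂ] E) → (F →L[ℂ] F)
  map_add : ∀ A B, IsTC A → IsTC B → toFun (A + B) = toFun A + toFun B
  map_smul : ∀ (c : ℂ) A, IsTC A → toFun (c • A) = c • toFun A
  maps_tc : ∀ A, IsTC A → IsTC (toFun A)
  pos : ∀ A, IsTC A → A.IsPositive → (toFun A).IsPositive

/-- A trace-non-increasing map. -/
def TraceMap.TNI (Φ : TraceMap E F) : Prop :=
  ∀ A, IsTC A → A.IsPositive → traceENN (Φ.toFun A) ≤ traceENN A

/-- A trace-preserving map. -/
def TraceMap.TP (Φ : TraceMap E F) : Prop :=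
  ∀ A, IsTC A → A.IsPositive → traceENN (Φ.toFun A) = traceENN A

/-- A map bounded with respect to the trace norm. -/
def TraceMap.Bounded (Φ : TraceMap E F) : Prop :=
  ∃ C : ℝ≥0, ∀ A, traceNorm (Φ.toFun A) ≤ (C : ℝ≥0∞) * traceNorm A

/-- The output entropy `H_Φ = H ∘ Φ`. -/
def outEntropy (Φ : TraceMap E F) (A : E →L[ℂ] E) : ℝ≥0∞ := qEntropy (Φ.toFun A)

/-- The rank-one operator `|x⟩⟨x|`. -/
def rankOne (x : E) : E →L[ℂ] E := (innerSL ℂ x).smulRight x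

/-- The rank-one operator `|x⟩⟨y|`. -/
def rankOneM (x y : E) : E →L[ℂ] E := (innerSL ℂ y).smulRight x

end Defs

section Defs2

variable {E F G : Type*}
variable [NormedAddCommGroup E] [InnerProductSpace ℂ E] [CompleteSpace E]
variable [NormedAddCommGroup F] [InnerProductSpace ℂ F] [CompleteSpace F]
variable [NormedAddCommGroup G] [InnerProductSpace ℂ G] [CompleteSpace G]

/-- The completely positive map `A ↦ ∑ᵢ Vᵢ A Vᵢ*` defined by a sequence of Kraus
operators. -/
def krausMap (V : ℕ → (E →L[ℂ] F)) (A : E →L[ℂ] E) : F →L[ℂ] F :=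
  ∑' i, V i ∘L A ∘L ContinuousLinearMap.adjoint (V i)

/-- The Kraus condition `∑ᵢ Vᵢ* Vᵢ ≤ I` (all partial sums are dominated by `I`). -/
def KrausTNI (V : ℕ → (E →L[ℂ] F)) : Prop :=
  ∀ n : ℕ,
    ((1 : E →L[ℂ] E) - ∑ i ∈ Finset.range n, ContinuousLinearMap.adjoint (V i) ∘L V i).IsPositive

/-- The Kraus condition `∑ᵢ Vᵢ* Vᵢ = I` (strong convergence), i.e. trace preservation. -/
def KrausTP (V : ℕ → (E →L[ℂ] F)) : Prop :=
  ∀ x : E, HasSum (fun i => (ContinuousLinearMap.adjoint (V i)) (V i x)) x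

/-- `(Φ, Φt)` is a complementary pair of quantum operations: for some Kraus
representation `Φ(·) = ∑ᵢ Vᵢ (·) Vᵢ*` and some orthonormal basis `{bᵢ}` of `G`,
`Φt(A) = ∑_{i,j} Tr[Vᵢ A Vⱼ*] |bᵢ⟩⟨bⱼ|` (characterized by its matrix entries). -/
def IsComplementaryPair (Φ : TraceMap E F) (Φt : TraceMap E G) : Prop :=
  ∃ (V : ℕ → (E →L[ℂ] F)) (b : HilbertBasis ℕ ℂ G),
    KrausTNI V ∧
    (∀ A, IsTC A → Φ.toFun A = krausMap V A) ∧
    (∀ A, IsTC A → ∀ i j : ℕ,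
      (inner ℂ (b i) (Φt.toFun A (b j)) : ℂ) =
        traceC (V i ∘L A ∘L ContinuousLinearMap.adjoint (V j)))

/-- A map (on trace-class operators) preserves continuity of the entropy:
its output entropy is continuous on every subset of the positive trace-class cone on
which the von Neumann entropy is continuous. -/
def PCE (Φf : (E →L[ℂ] E) → (F →L[ℂ] F)) : Prop :=
  ∀ 𝒜 : Set (E →L[ℂ] E), 𝒜 ⊆ posTC E → ContOn qEntropy 𝒜 →
    ContOn (fun A => qEntropy (Φf A)) 𝒜

/-- `μ` is the sequence of nonzero eigenvalues (with multiplicities, possibly padded by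
zeros) of the diagonalizable positive operator `T`, every vector orthogonal to the
eigenvectors being annihilated by `T`. -/
def IsEigenSeq (T : E →L[ℂ] E) (μ : ℕ → ℝ) : Prop :=
  ∃ e : ℕ → E,
    (∀ i j, i ≠ j → (inner ℂ (e i) (e j) : ℂ) = 0) ∧
    (∀ i, (μ i ≠ 0 → ‖e i‖ = 1) ∧ (μ i = 0 → e i = 0)) ∧
    (∀ i, T (e i) = (μ i : ℂ) • e i) ∧
    (∀ x : E, (∀ i, (inner ℂ (e i) x : ℂ) = 0) → T x = 0)

/-- `ν` is the sequence of singular values of `V` (eigenvalues of `√(V*V)`,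
equivalently `ν²` are the eigenvalues of `V*V`). -/
def IsSingularValues (V : E →L[ℂ] F) (ν : ℕ → ℝ) : Prop :=
  (∀ i, 0 ≤ ν i) ∧ IsEigenSeq (ContinuousLinearMap.adjoint V ∘L V) (fun i => ν i ^ 2)

/-- `∑ᵢ e^{−l/νᵢ²}`, the sum being taken over the indices with `νᵢ ≠ 0`. -/
def expSum (ν : ℕ → ℝ) (l : ℝ) : ℝ≥0∞ :=
  ∑' i, if ν i = 0 then 0 else ENNReal.ofReal (Real.exp (-(l / ν i ^ 2)))

/-- `λ*(V) < ∞`: `V` is compact (automatic here) and `∑ᵢ e^{−l/νᵢ²} < ∞` for some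
`l > 0`, where `{νᵢ}` are the singular values of `V`. -/
def LamStarFin (V : E →L[ℂ] F) : Prop :=
  ∃ ν : ℕ → ℝ, IsSingularValues V ν ∧ ∃ l : ℝ, 0 < l ∧ expSum ν l ≠ ∞

/-- `λ*(√S) < ∞` for a positive operator `S` (the singular values of `√S` are the
square roots of the eigenvalues of `S`). -/
def LamStarSqrtFin (S : E →L[ℂ] E) : Prop :=
  ∃ ν : ℕ → ℝ, (∀ i, 0 ≤ ν i) ∧ IsEigenSeq S (fun i => ν i ^ 2) ∧
    ∃ l : ℝ, 0 < l ∧ expSum ν l ≠ ∞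

/-- The value `λ*` associated to a sequence `ν` of singular values: the unique solution
of `∑ᵢ e^{−λ/νᵢ²} = 1` if it exists, and `inf{λ > 0 | ∑ᵢ e^{−λ/νᵢ²} < ∞}` otherwise. -/
def lamStarOf (ν : ℕ → ℝ) : ℝ≥0∞ :=
  if h : ∃ l : ℝ, expSum ν l = 1 then ENNReal.ofReal h.choose
  else ⨅ (l : ℝ) (_ : 0 < l ∧ expSum ν l ≠ ∞), ENNReal.ofReal l

/-- The parameter `λ*(V) ∈ [0,∞]` of a bounded operator `V`. -/
def lamStar (V : E →L[ℂ] F) : ℝ≥0∞ :=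
  if h : ∃ ν : ℕ → ℝ, IsSingularValues V ν then lamStarOf h.choose else ∞

/-- `rank A ≤ k`. -/
def rankLE (A : E →L[ℂ] E) (k : ℕ) : Prop :=
  Module.rank ℂ (LinearMap.range (A : E →ₗ[ℂ] E)) ≤ k

/-- The set `𝔗₊ᵏ(E)` of positive (trace-class) operators of rank at most `k`. -/
def rankCone (E : Type*) [NormedAddCommGroup E] [InnerProductSpace ℂ E] [CompleteSpace E]
    (k : ℕ) : Set (E →L[ℂ] E) := {A | A.IsPositive ∧ rankLE A k}

/-- A decomposition of `A` into a countable convex combination of positive operators of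
rank at most `k`. -/
structure Decomp (k : ℕ) (A : E →L[ℂ] E) where
  π : ℕ → ℝ
  op : ℕ → (E →L[ℂ] E)
  π_nonneg : ∀ i, 0 ≤ π i
  π_sum : HasSum π 1
  op_pos : ∀ i, (op i).IsPositive
  op_rank : ∀ i, rankLE (op i) k
  sum_eq : HasSum (fun i => π i • op i) A

/-- The `k`-order approximator `H_Φᵏ` of the output entropy of `Φ`. -/
def kApprox (Φf : (E →L[ℂ] E) → (F →L[ℂ] F)) (k : ℕ) (A : E →L[ℂ] E) : ℝ≥0∞ :=
  ⨆ d : Decomp k A, ∑' i, ENNReal.ofReal (d.π i) * qEntropy (Φf (d.op i))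

/-- The set of pure states (extreme points of `𝔖(E)`). -/
def pureStates (E : Type*) [NormedAddCommGroup E] [InnerProductSpace ℂ E]
    [CompleteSpace E] : Set (E →L[ℂ] E) := {A | ∃ x : E, ‖x‖ = 1 ∧ A = rankOne x}

end Defs2

section Tensor

variable (E F G : Type*)
variable [NormedAddCommGroup E] [InnerProductSpace ℂ E] [CompleteSpace E]
variable [NormedAddCommGroup F] [InnerProductSpace ℂ F] [CompleteSpace F]
variable [NormedAddCommGroup G] [InnerProductSpace ℂ G] [CompleteSpace G]

/-- A realization of `G` as the Hilbert tensor product `E ⊗ F`, together with the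
tensor product of (bounded) operators. -/
structure TensorData where
  tmul : E → F → G
  add_left : ∀ x y z, tmul (x + y) z = tmul x z + tmul y z
  add_right : ∀ x y z, tmul x (y + z) = tmul x y + tmul x z
  smul_left : ∀ (c : ℂ) x y, tmul (c • x) y = c • tmul x y
  smul_right : ∀ (c : ℂ) x y, tmul x (c • y) = c • tmul x y
  inner_tmul : ∀ x x' y y',
    (inner ℂ (tmul x y) (tmul x' y') : ℂ) = (inner ℂ x x' : ℂ) * (inner ℂ y y' : ℂ)
  dense_span : Dense ((Submodule.span ℂ {z | ∃ x y, z = tmul x y} : Submodule ℂ G) : Set G)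
  omul : (E →L[ℂ] E) → (F →L[ℂ] F) → (G →L[ℂ] G)
  omul_tmul : ∀ A B x y, omul A B (tmul x y) = tmul (A x) (B y)

end Tensor

section Spectral

variable {E : Type*} [NormedAddCommGroup E] [InnerProductSpace ℂ E]

theorem orthonormal_option_elim {ι : Type*} {e : ι → E} (he : Orthonormal ℂ e) {x : E}
    (hx : ‖x‖ = 1) (hxe : ∀ i, (inner ℂ (e i) x : ℂ) = 0) :
    Orthonormal ℂ (fun o : Option ι => o.elim x e) := by
  refine ⟨?_, ?_⟩
  · rintro (_ | i)
    · exact hx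
    · exact he.1 i
  · rintro (_ | i) (_ | j) hij
    · exact absurd rfl hij
    · exact inner_eq_zero_symm.1 (hxe j)
    · exact hxe i
    · exact he.2 fun h => hij (h ▸ rfl)

theorem sum_inner_le_traceNorm {ι : Type*} [Fintype ι] (A : E →L[ℂ] E) {e f : ι → E}
    (he : Orthonormal ℂ e) (hf : Orthonormal ℂ f) :
    ∑ i, ENNReal.ofReal ‖(inner ℂ (e i) (A (f i)) : ℂ)‖ ≤ traceNorm A := by
  let σ := (Fintype.equivFin ι).symm
  have h : ∑ i, ENNReal.ofReal ‖(inner ℂ ((e ∘ σ) i) (A ((f ∘ σ) i)) : ℂ)‖ ≤ traceNorm A := by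
    unfold traceNorm
    exact le_iSup_of_le (Fintype.card ι) <| le_iSup_of_le (e ∘ σ) <| le_iSup_of_le (f ∘ σ) <|
      le_iSup_of_le (he.comp _ σ.injective) <| le_iSup_of_le (hf.comp _ σ.injective) le_rfl
  exact (Equiv.sum_comp σ fun i =>
    ENNReal.ofReal ‖(inner ℂ (e i) (A (f i)) : ℂ)‖).symm.trans_le h

theorem tsum_inner_le_traceNorm {ι : Type*} (A : E →L[ℂ] E) {e f : ι → E}
    (he : Orthonormal ℂ e) (hf : Orthonormal ℂ f) :
    ∑' i, ENNReal.ofReal ‖(inner ℂ (e i) (A (f i)) : ℂ)‖ ≤ traceNorm A := by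
  rw [ENNReal.tsum_eq_iSup_sum]
  refine iSup_le fun s => ?_
  rw [← Finset.sum_coe_sort]
  exact sum_inner_le_traceNorm A (he.comp _ Subtype.val_injective)
    (hf.comp _ Subtype.val_injective)

/-- A trace-class operator is small on the complement of suitable finite-dimensional
subspaces. -/
theorem IsTC.exists_small_off_span {A : E →L[ℂ] E} (hA : IsTC A) {δ : ℝ} (hδ : 0 < δ) :
    ∃ (n : ℕ) (e f : Fin n → E), ∀ x y : E, (∀ i, (inner ℂ (f i) x : ℂ) = 0) →
      (∀ i, (inner ℂ (e i) y : ℂ) = 0) → ‖(inner ℂ y (A x) : ℂ)‖ ≤ δ * ‖y‖ * ‖x‖ := by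
  have hδ' : ENNReal.ofReal δ ≠ 0 := by simpa using hδ
  obtain ⟨n, e, f, he, hf, hef⟩ : ∃ (n : ℕ) (e f : Fin n → E), Orthonormal ℂ e ∧
      Orthonormal ℂ f ∧ traceNorm A ≤
        ∑ i, ENNReal.ofReal ‖(inner ℂ (e i) (A (f i)) : ℂ)‖ + ENNReal.ofReal δ := by
    by_contra! H
    have h0 := H 0 Fin.elim0 Fin.elim0 ⟨fun i => i.elim0, fun i => i.elim0⟩
      ⟨fun i => i.elim0, fun i => i.elim0⟩
    have h1 : traceNorm A ≤ traceNorm A - ENNReal.ofReal δ := by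
      conv_lhs => unfold traceNorm
      refine iSup_le fun n => iSup_le fun e => iSup_le fun f => iSup_le fun he =>
        iSup_le fun hf => ?_
      exact ENNReal.le_sub_of_add_le_right ENNReal.ofReal_ne_top (H n e f he hf).le
    exact absurd h1 (not_le.2 (ENNReal.sub_lt_self hA (ne_bot_of_gt h0) hδ'))
  refine ⟨n, e, f, fun x y hx hy => ?_⟩
  rcases eq_or_ne x 0 with rfl | hx0
  · simp
  rcases eq_or_ne y 0 with rfl | hy0
  · simp
  have hxn : 0 < ‖x‖ := norm_pos_iff.2 hx0
  have hyn : 0 < ‖y‖ := norm_pos_iff.2 hy0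
  have hx1 : ‖((‖x‖⁻¹ : ℝ) : ℂ) • x‖ = 1 := by
    rw [norm_smul, Complex.norm_real, norm_inv, norm_norm, inv_mul_cancel₀ hxn.ne']
  have hy1 : ‖((‖y‖⁻¹ : ℝ) : ℂ) • y‖ = 1 := by
    rw [norm_smul, Complex.norm_real, norm_inv, norm_norm, inv_mul_cancel₀ hyn.ne']
  have h := sum_inner_le_traceNorm A
    (orthonormal_option_elim he hy1 fun i => by rw [inner_smul_right, hy i, mul_zero])
    (orthonormal_option_elim hf hx1 fun i => by rw [inner_smul_right, hx i, mul_zero])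
  rw [Fintype.sum_option] at h
  have hfin : ∑ i, ENNReal.ofReal ‖(inner ℂ (e i) (A (f i)) : ℂ)‖ ≠ ∞ := by simp
  have h2 := h.trans hef
  simp only [Option.elim] at h2
  rw [add_comm] at h2
  have h3 := (ENNReal.add_le_add_iff_left hfin).1 h2
  rw [ENNReal.ofReal_le_ofReal_iff hδ.le, map_smul, inner_smul_left, inner_smul_right] at h3
  simp only [norm_mul, Complex.conj_ofReal, Complex.norm_real, norm_inv, norm_norm] at h3
  rw [← mul_assoc, ← mul_inv, inv_mul_le_iff₀ (by positivity)] at h3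
  linarith

theorem isCompactOperator_starProjection (P : Submodule ℂ E) [FiniteDimensional ℂ P] :
    IsCompactOperator (P.starProjection : E →L[ℂ] E) := by
  have : IsCompactOperator (P.subtypeL ∘L P.orthogonalProjectionOnto : E →L[ℂ] E) := by
    have : ProperSpace P := FiniteDimensional.proper ℂ P
    have hP : IsCompactOperator (P.orthogonalProjectionOnto : E →L[ℂ] P) :=
      isCompactOperator_of_locallyCompactSpace_dom _
    exact hP.clm_comp P.subtypeL
  exact this

variable [CompleteSpace E]

theorem IsTC.isCompactOperator {A : E →L[ℂ] E} (hA : IsTC A) : IsCompactOperator A := by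
  have hmem : A ∈ closure {f : E →L[ℂ] E | IsCompactOperator f} := by
    rw [Metric.mem_closure_iff]
    intro ε hε
    obtain ⟨n, e, f, hef⟩ := hA.exists_small_off_span (half_pos hε)
    let P := Submodule.span ℂ (Set.range e)
    let Q := Submodule.span ℂ (Set.range f)
    have : FiniteDimensional ℂ P := FiniteDimensional.span_of_finite ℂ (Set.finite_range e)
    have : FiniteDimensional ℂ Q := FiniteDimensional.span_of_finite ℂ (Set.finite_range f)
    let p := P.starProjection
    let q := Q.starProjection
    refine ⟨p ∘L A + (A ∘L q - p ∘L A ∘L q), ?_, ?_⟩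
    · have hp : IsCompactOperator p := isCompactOperator_starProjection P
      have hq : IsCompactOperator q := isCompactOperator_starProjection Q
      exact (hp.comp_clm A).add ((hq.clm_comp A).sub ((hp.comp_clm A).comp_clm q))
    · rw [dist_eq_norm]
      refine lt_of_le_of_lt (ContinuousLinearMap.opNorm_le_bound _ (half_pos hε).le fun x => ?_)
        (half_lt_self hε)
      set z := A (x - q x) with hz
      have hB : (A - (p ∘L A + (A ∘L q - p ∘L A ∘L q))) x = z - p z := by
        simp only [hz, sub_apply, add_apply,
          ContinuousLinearMap.comp_apply, map_sub]
        abel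
      rw [hB]
      have hzp : z - p z ∈ Pᗮ := Submodule.sub_starProjection_mem_orthogonal z
      have hxq : x - q x ∈ Qᗮ := Submodule.sub_starProjection_mem_orthogonal x
      have h1 := hef (x - q x) (z - p z)
        (fun i => hxq (f i) (Submodule.subset_span ⟨i, rfl⟩))
        (fun i => hzp (e i) (Submodule.subset_span ⟨i, rfl⟩))
      have h2 : (inner ℂ (z - p z) z : ℂ) = inner ℂ (z - p z) (z - p z) := by
        have : (inner ℂ (z - p z) (p z) : ℂ) = 0 :=
          inner_eq_zero_symm.1 (hzp _ (Submodule.starProjection_apply_mem P z))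
        rw [inner_sub_right, this, sub_zero]
      rw [h2, inner_self_eq_norm_sq_to_K] at h1
      have h3 : ‖x - q x‖ ≤ ‖x‖ := by
        have h4 : (inner ℂ (x - q x) (q x) : ℂ) = 0 :=
          inner_eq_zero_symm.1 (hxq _ (Submodule.starProjection_apply_mem Q x))
        have := norm_add_sq_eq_norm_sq_add_norm_sq_of_inner_eq_zero _ _ h4
        rw [sub_add_cancel] at this
        nlinarith [norm_nonneg (q x), norm_nonneg x, norm_nonneg (x - q x)]
      have h5 : ‖z - p z‖ * ‖z - p z‖ ≤ ε / 2 * ‖z - p z‖ * ‖x - q x‖ := by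
        simpa [sq] using h1
      rcases (norm_nonneg (z - p z)).eq_or_lt with h0 | h0
      · rw [← h0]; positivity
      · have : ‖z - p z‖ ≤ ε / 2 * ‖x - q x‖ := by
          by_contra! h6
          nlinarith
        exact this.trans (by gcongr)
  exact isClosed_setOfPred_isCompactOperator.closure_subset hmem

/-- The orthonormal basis `e` consists of eigenvectors of `A`, with eigenvalues `a`. -/
def IsEigenbasis {ι : Type*} (A : E →L[ℂ] E) (e : HilbertBasis ι ℂ E) (a : ι → ℝ) : Prop :=
  ∀ k, A (e k) = (a k : ℂ) • e k

theorem IsTC.exists_isEigenbasis {E : Type*} [NormedAddCommGroup E] [InnerProductSpace ℂ E]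
    [CompleteSpace E] {A : E →L[ℂ] E} (hA : IsTC A) (hs : (A : E →ₗ[ℂ] E).IsSymmetric) :
    ∃ (s : Set E) (e : HilbertBasis s ℂ E) (a : s → ℝ), ⇑e = ((↑) : s → E) ∧
      IsEigenbasis A e a := by
  let V : ℂ → Submodule ℂ E := fun μ => Module.End.eigenspace (A : E →ₗ[ℂ] E) μ
  have hVc : ∀ μ, CompleteSpace (V μ) := fun μ => by
    have : IsClosed (V μ : Set E) := by
      have : (V μ : Set E) = {x | A x = μ • x} := by
        ext x
        exact Module.End.mem_eigenspace_iff
      rw [this]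
      exact isClosed_eq A.continuous (continuous_const_smul μ)
    exact this.completeSpace_coe
  choose w b hb using fun μ => exists_hilbertBasis ℂ (V μ)
  let v : (Σ μ, w μ) → E := fun i => (b i.1 i.2 : E)
  have hv : Orthonormal ℂ v :=
    hs.orthogonalFamily_eigenspaces.orthonormal_sigma_orthonormal fun μ => (b μ).orthonormal
  have hbot : (Submodule.span ℂ (Set.range v))ᗮ = ⊥ := by
    rw [eq_bot_iff, ← ContinuousLinearMap.orthogonalComplement_iSup_eigenspaces_eq_bot
      hA.isCompactOperator hs]
    intro x hx
    rw [← Submodule.iInf_orthogonal, Submodule.mem_iInf]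
    intro μ u hu
    have h1 := (b μ).hasSum_repr ⟨u, hu⟩
    have h2 := (h1.mapL (V μ).subtypeL).mapL (innerSL ℂ x)
    have h3 : ∀ i, innerSL ℂ x ((V μ).subtypeL ((b μ).repr ⟨u, hu⟩ i • (b μ) i)) = 0 := by
      intro i
      rw [map_smul, map_smul]
      have : (inner ℂ x ((b μ i : V μ) : E) : ℂ) = 0 :=
        inner_eq_zero_symm.1 (hx _ (Submodule.subset_span ⟨⟨μ, i⟩, rfl⟩))
      simp [innerSL_apply_apply, this]
    rw [funext h3] at h2
    have h4 := h2.unique hasSum_zero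
    exact inner_eq_zero_symm.1 h4
  have hvA : ∀ i, A (v i) = i.1 • v i := fun i =>
    Module.End.mem_eigenspace_iff.1 (b i.1 i.2).2
  have hvr : Orthonormal ℂ ((↑) : Set.range v → E) := hv.toSubtypeRange
  have hbot' : (Submodule.span ℂ (Set.range ((↑) : Set.range v → E)))ᗮ = ⊥ := by
    rwa [Subtype.range_coe]
  refine ⟨Set.range v, HilbertBasis.mkOfOrthogonalEqBot hvr hbot',
    fun x => (inner ℂ (x : E) (A x) : ℂ).re, HilbertBasis.coe_mkOfOrthogonalEqBot _ _, ?_⟩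
  intro x
  rw [HilbertBasis.coe_mkOfOrthogonalEqBot]
  obtain ⟨i, hi⟩ := x.2
  have hne : (v i) ≠ 0 := hv.ne_zero i
  have hconj := hs.conj_eigenvalue_eq_self
    (Module.End.hasEigenvalue_of_hasEigenvector ⟨Module.End.mem_eigenspace_iff.2 (hvA i), hne⟩)
  have hre : ((i.1.re : ℝ) : ℂ) = i.1 := Complex.conj_eq_iff_re.1 hconj
  have hx : (inner ℂ (x : E) (A x) : ℂ) = i.1 := by
    rw [← hi, hvA, inner_smul_right, inner_self_eq_norm_sq_to_K, hv.1 i]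
    simp
  simp only [hx, hre]
  rw [← hi, hvA]

end Spectral

section Sums

variable {ι κ θ : Type*}

theorem hasSum_of_tsum_ofReal_eq {x : ι → ℝ} {X : ℝ} (hx : ∀ i, 0 ≤ x i) (hX : 0 ≤ X)
    (h : ∑' i, ENNReal.ofReal (x i) = ENNReal.ofReal X) : HasSum x X := by
  have h2 := ENNReal.hasSum_toReal (f := fun i => ENNReal.ofReal (x i))
    (by rw [h]; exact ENNReal.ofReal_ne_top)
  rw [← ENNReal.tsum_toReal_eq fun i => ENNReal.ofReal_ne_top, h, ENNReal.toReal_ofReal hX] at h2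
  exact h2.congr_fun fun i => (ENNReal.toReal_ofReal (hx i)).symm

/-- The sum `∑ᵢ xᵢ log⁺(M / xᵢ)` over a nonnegative family. -/
def relSum (M : ℝ) (x : ι → ℝ) : ℝ≥0∞ :=
  ∑' i, ENNReal.ofReal (x i * Real.log (M / x i))

/-- The regularization `∑ᵢ xᵢ log(M / max xᵢ ε)` of `relSum M x`. -/
def cutSum (M ε : ℝ) (x : ι → ℝ) : ℝ≥0∞ :=
  ∑' i, ENNReal.ofReal (x i * Real.log (M / max (x i) ε))

/-- The sum of the members of a family which are smaller than `ε`. -/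
def tailSum (ε : ℝ) (x : ι → ℝ) : ℝ≥0∞ :=
  ∑' i, ENNReal.ofReal (if x i < ε then x i else 0)

theorem relSum_eq_cutSum_add {M ε : ℝ} {x : ι → ℝ} (hε : 0 < ε) (hεM : ε ≤ M)
    (hx : ∀ i, 0 ≤ x i) :
    relSum M x = cutSum M ε x + relSum ε x := by
  unfold relSum cutSum
  rw [← ENNReal.tsum_add]
  refine tsum_congr fun i => ?_
  rcases (hx i).eq_or_lt with h0 | h0
  · simp [← h0]
  rcases le_total (x i) ε with h | h
  · rw [max_eq_right h, ← ENNReal.ofReal_add, ← mul_add, ← Real.log_mul, div_mul_div_cancel₀ hε.ne']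
    · exact (div_pos (hε.trans_le hεM) hε).ne'
    · exact (div_pos hε h0).ne'
    · exact mul_nonneg h0.le (Real.log_nonneg ((one_le_div hε).2 hεM))
    · exact mul_nonneg h0.le (Real.log_nonneg ((one_le_div h0).2 h))
  · rw [max_eq_left h]
    have : x i * Real.log (ε / x i) ≤ 0 :=
      mul_nonpos_of_nonneg_of_nonpos h0.le
        (Real.log_nonpos (div_nonneg hε.le h0.le) ((div_le_one h0).2 h))
    rw [ENNReal.ofReal_of_nonpos this, add_zero]

theorem relSum_mono {M N : ℝ} {x : ι → ℝ} (hM : 0 < M) (hMN : M ≤ N) (hx : ∀ i, 0 ≤ x i) :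
    relSum M x ≤ relSum N x := by
  refine ENNReal.tsum_le_tsum fun i => ENNReal.ofReal_le_ofReal ?_
  rcases (hx i).eq_or_lt with h0 | h0
  · simp [← h0]
  · have := Real.log_le_log (div_pos hM h0) (div_le_div_of_nonneg_right hMN h0.le)
    exact mul_le_mul_of_nonneg_left this h0.le

theorem cutSum_ne_top {M ε : ℝ} {x : ι → ℝ} (hε : 0 < ε) (hM : 0 < M)
    (hx : ∀ i, 0 ≤ x i) (hs : ∑' i, ENNReal.ofReal (x i) ≠ ∞) : cutSum M ε x ≠ ∞ := by
  have h : cutSum M ε x ≤ ∑' i, ENNReal.ofReal (x i) * ENNReal.ofReal (Real.log (M / ε)) := by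
    refine ENNReal.tsum_le_tsum fun i => ?_
    rw [← ENNReal.ofReal_mul (hx i)]
    refine ENNReal.ofReal_le_ofReal (mul_le_mul_of_nonneg_left ?_ (hx i))
    have h1 : 0 < max (x i) ε := lt_max_of_lt_right hε
    exact Real.log_le_log (div_pos hM h1)
      (div_le_div_of_nonneg_left hM.le hε (le_max_right _ _))
  rw [ENNReal.tsum_mul_right] at h
  exact ne_top_of_le_ne_top (ENNReal.mul_ne_top hs ENNReal.ofReal_ne_top) h

theorem tailSum_add_cutSum_le {M ε : ℝ} {x : ι → ℝ} (hε : 0 < ε)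
    (hεM : Real.exp 1 * ε ≤ M) (hx : ∀ i, 0 ≤ x i) :
    tailSum ε x + cutSum M (Real.exp 1 * ε) x ≤ cutSum M ε x := by
  unfold tailSum cutSum
  rw [← ENNReal.tsum_add]
  refine ENNReal.tsum_le_tsum fun i => ?_
  have he : ε ≤ Real.exp 1 * ε := le_mul_of_one_le_left hε.le (Real.one_le_exp zero_le_one)
  have he0 : 0 < Real.exp 1 * ε := hε.trans_le he
  have hM : 0 < M := he0.trans_le hεM
  split_ifs with h
  · rw [max_eq_right h.le, max_eq_right (h.le.trans he), ← ENNReal.ofReal_add (hx i)]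
    · refine ENNReal.ofReal_le_ofReal (le_of_eq ?_)
      rw [Real.log_div hM.ne' he0.ne', Real.log_mul (Real.exp_pos 1).ne' hε.ne', Real.log_exp,
        Real.log_div hM.ne' hε.ne']
      ring
    · exact mul_nonneg (hx i) (Real.log_nonneg ((one_le_div he0).2 hεM))
  · rw [ENNReal.ofReal_zero, zero_add]
    refine ENNReal.ofReal_le_ofReal (mul_le_mul_of_nonneg_left ?_ (hx i))
    have h1 : 0 < max (x i) ε := lt_max_of_lt_right hε
    have h2 : max (x i) ε ≤ max (x i) (Real.exp 1 * ε) := max_le_max le_rfl he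
    exact Real.log_le_log (div_pos hM (h1.trans_le h2)) (div_le_div_of_nonneg_left hM.le h1 h2)

theorem exists_relSum_lt {M : ℝ} {x : ι → ℝ} (hM : 0 < M) (hx : ∀ i, 0 ≤ x i)
    (hs : relSum M x ≠ ∞) {η : ℝ≥0∞} (hη : η ≠ 0) :
    ∃ ε, 0 < ε ∧ ε ≤ M ∧ relSum ε x < η := by
  have h := (ENNReal.tendsto_tsum_compl_atTop_zero hs).eventually_lt_const (pos_iff_ne_zero.2 hη)
  obtain ⟨s, hs'⟩ := h.exists
  obtain ⟨ε, hε, hεM, hεs⟩ : ∃ ε, 0 < ε ∧ ε ≤ M ∧ ∀ i ∈ s, x i = 0 ∨ ε ≤ x i := by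
    clear hs'
    induction s using Finset.induction_on with
    | empty => exact ⟨M, hM, le_rfl, by simp⟩
    | insert j s _ ih =>
      obtain ⟨ε, hε, hεM, hεs⟩ := ih
      rcases (hx j).eq_or_lt with h0 | h0
      · refine ⟨ε, hε, hεM, fun i hi => ?_⟩
        rcases Finset.mem_insert.1 hi with rfl | hi
        · exact Or.inl h0.symm
        · exact hεs i hi
      · refine ⟨min ε (x j), lt_min hε h0, (min_le_left _ _).trans hεM, fun i hi => ?_⟩
        rcases Finset.mem_insert.1 hi with rfl | hi
        · exact Or.inr (min_le_right _ _)
        · exact (hεs i hi).imp_right (min_le_left _ _).trans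
  refine ⟨ε, hε, hεM, lt_of_le_of_lt ?_ hs'⟩
  have hzero : ∀ i ∈ s, ENNReal.ofReal (x i * Real.log (ε / x i)) = 0 := by
    intro i hi
    rcases hεs i hi with h0 | h0
    · simp [h0]
    · exact ENNReal.ofReal_of_nonpos (mul_nonpos_of_nonneg_of_nonpos (hx i)
        (Real.log_nonpos (div_nonneg hε.le (hx i)) (div_le_one_of_le₀ h0 (hx i))))
  have hsplit : relSum ε x = ∑' i : { i // i ∉ s }, ENNReal.ofReal (x i * Real.log (ε / x i)) := by
    refine (tsum_subtype_eq_of_support_subset (s := {i | i ∉ s})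
      (f := fun i => ENNReal.ofReal (x i * Real.log (ε / x i))) fun i hi his => ?_).symm
    exact hi (hzero i his)
  rw [hsplit]
  refine ENNReal.tsum_le_tsum fun i => ENNReal.ofReal_le_ofReal ?_
  rcases (hx i).eq_or_lt with h0 | h0
  · simp [← h0]
  · exact mul_le_mul_of_nonneg_left (Real.log_le_log (div_pos hε h0)
      (div_le_div_of_nonneg_right hεM h0.le)) h0.le

theorem relSum_eq_add_of_tsum_eq {M X : ℝ} {x : ι → ℝ} (hM : 0 < M) (hX : 0 ≤ X) (hXM : X ≤ M)
    (hx : ∀ i, 0 ≤ x i) (hs : ∑' i, ENNReal.ofReal (x i) = ENNReal.ofReal X) :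
    relSum M x = relSum X x + ENNReal.ofReal (X * Real.log (M / X)) := by
  have hxX : ∀ i, x i ≤ X := fun i => by
    rw [← ENNReal.ofReal_le_ofReal_iff hX, ← hs]
    exact ENNReal.le_tsum i
  rcases hX.eq_or_lt with rfl | hX0
  · have h0 : ∀ i, x i = 0 := fun i => le_antisymm (hxX i) (hx i)
    simp [relSum, h0]
  have hlog : 0 ≤ Real.log (M / X) := Real.log_nonneg ((one_le_div hX0).2 hXM)
  rw [ENNReal.ofReal_mul hX, ← hs, ← ENNReal.tsum_mul_right]
  unfold relSum
  rw [← ENNReal.tsum_add]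
  refine tsum_congr fun i => ?_
  rcases (hx i).eq_or_lt with h0 | h0
  · simp [← h0]
  rw [← ENNReal.ofReal_mul (hx i), ← ENNReal.ofReal_add, ← mul_add, ← Real.log_mul,
    mul_comm (X / x i), div_mul_div_cancel₀ hX0.ne']
  · exact (div_pos hX0 h0).ne'
  · exact (div_pos hM hX0).ne'
  · exact mul_nonneg h0.le (Real.log_nonneg ((one_le_div h0).2 (hxX i)))
  · exact mul_nonneg h0.le hlog

theorem clEntropy_eq_relSum {X : ℝ} {x : ι → ℝ} (hx : ∀ i, 0 ≤ x i) (hs : HasSum x X) :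
    clEntropy x = relSum X x := by
  have hX : 0 ≤ X := hs.nonneg hx
  unfold clEntropy relSum
  rw [hs.tsum_eq, ← ENNReal.tsum_mul_left]
  refine tsum_congr fun i => ?_
  rw [← ENNReal.ofReal_mul hX, Real.negMulLog]
  rcases hX.eq_or_lt with rfl | hX0
  · have h0 : x i = 0 := le_antisymm (le_hasSum hs i fun j _ => hx j) (hx i)
    simp [h0]
  · rw [← inv_div X (x i), Real.log_inv]
    congr 1
    field_simp

/-- Jensen's inequality for an affine majorant. -/
theorem tsum_ofReal_mul_le_of_le_affine {p b φ : ι → ℝ} {β r c d : ℝ} (hp : ∀ l, 0 ≤ p l)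
    (hp1 : HasSum p 1) (hpb : HasSum (fun l => p l * b l) β) (hφ : ∀ l, 0 ≤ φ l)
    (h : ∀ l, p l ≠ 0 → φ l ≤ r + c * (b l - d)) :
    ∑' l, ENNReal.ofReal (p l) * ENNReal.ofReal (φ l) ≤ ENNReal.ofReal (r + c * (β - d)) := by
  have h1 : HasSum (fun l => p l * (r + c * (b l - d))) (r + c * (β - d)) := by
    have h2 := (hp1.mul_left (r - c * d)).add (hpb.mul_left c)
    have h3 : r + c * (β - d) = (r - c * d) * 1 + c * β := by ring
    rw [h3]
    exact h2.congr_fun fun l => by ring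
  have h3 : ∀ l, p l * φ l ≤ p l * (r + c * (b l - d)) := fun l => by
    by_cases h0 : p l = 0
    · simp [h0]
    · exact mul_le_mul_of_nonneg_left (h l h0) (hp l)
  have h4 : ∀ l, 0 ≤ p l * φ l := fun l => mul_nonneg (hp l) (hφ l)
  have h5 : Summable fun l => p l * φ l := Summable.of_nonneg_of_le h4 h3 h1.summable
  calc ∑' l, ENNReal.ofReal (p l) * ENNReal.ofReal (φ l)
      = ENNReal.ofReal (∑' l, p l * φ l) := by
        rw [ENNReal.ofReal_tsum_of_nonneg h4 h5]
        exact tsum_congr fun l => (ENNReal.ofReal_mul (hp l)).symm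
    _ ≤ _ := ENNReal.ofReal_le_ofReal (hasSum_le h3 h5.hasSum h1)

theorem log_div_le_add_of_pos {a f g δ ε K : ℝ} (ha : 0 < a) (hf : 0 < f) (hg : 0 < g)
    (hδ : 0 < δ) (hδK : δ ≤ K) (hε : 0 < ε) :
    ENNReal.ofReal (Real.log (ε / f)) ≤ ENNReal.ofReal (Real.log (ε / g)) +
      ENNReal.ofReal (g * a / (f * K)) + ENNReal.ofReal (Real.log (δ / a)) +
      ENNReal.ofReal (if f < ε then Real.log (K / δ) else 0) := by
  have hK : 0 < K := hδ.trans_le hδK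
  by_cases hfε : f < ε
  · rw [if_pos hfε]
    have hpos : (0 : ℝ) ≤ g * a / (f * K) := by positivity
    have hKδ : 0 ≤ Real.log (K / δ) := Real.log_nonneg ((one_le_div hδ).2 hδK)
    have key : Real.log (ε / f) ≤ max (Real.log (ε / g)) 0 + g * a / (f * K) +
        max (Real.log (δ / a)) 0 + Real.log (K / δ) := by
      have h1 : Real.log (ε / f) = Real.log (ε / g) + Real.log (g * a / (f * K)) +
          Real.log (δ / a) + Real.log (K / δ) := by
        rw [Real.log_div hε.ne' hf.ne', Real.log_div hε.ne' hg.ne', Real.log_div (by positivity)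
          (by positivity), Real.log_mul hg.ne' ha.ne', Real.log_mul hf.ne' hK.ne',
          Real.log_div hδ.ne' ha.ne', Real.log_div hK.ne' hδ.ne']
        ring
      rw [h1]
      have h2 := Real.log_le_sub_one_of_pos (show 0 < g * a / (f * K) by positivity)
      have h3 := le_max_left (Real.log (ε / g)) 0
      have h4 := le_max_left (Real.log (δ / a)) 0
      linarith
    refine (ENNReal.ofReal_le_ofReal key).trans ?_
    refine ENNReal.ofReal_add_le.trans (add_le_add (ENNReal.ofReal_add_le.trans
      (add_le_add (ENNReal.ofReal_add_le.trans (add_le_add ?_ le_rfl)) ?_)) le_rfl)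
    · simp [ENNReal.ofReal_max]
    · simp [ENNReal.ofReal_max]
  · have : Real.log (ε / f) ≤ 0 :=
      Real.log_nonpos (by positivity) ((div_le_one hf).2 (not_lt.1 hfε))
    rw [ENNReal.ofReal_of_nonpos this]
    exact zero_le

/-- Comparison of the regularized entropies of two marginals of a family of weights. -/
theorem relSum_le_of_coupling {w : ι → κ → θ → ℝ≥0∞} {a : ι → ℝ} {f : κ → ℝ} {g : θ → ℝ}
    (ha0 : ∀ k, 0 ≤ a k) (hf0 : ∀ m, 0 ≤ f m) (hg0 : ∀ n, 0 ≤ g n)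
    (hf : ∀ m, ∑' k, ∑' n, w k m n = ENNReal.ofReal (f m))
    (hg : ∀ n, ∑' k, ∑' m, w k m n = ENNReal.ofReal (g n))
    (ha : ∀ k, ∑' m, ∑' n, w k m n ≤ ENNReal.ofReal (a k))
    (hw : ∀ k n, ∑' m, w k m n / ENNReal.ofReal (f m) ≤ 1)
    {δ ε K : ℝ} (hδ : 0 < δ) (hδK : δ ≤ K) (hε : 0 < ε) :
    relSum ε f ≤ relSum ε g +
      (∑' n, ENNReal.ofReal (g n)) * (∑' k, ENNReal.ofReal (a k)) / ENNReal.ofReal K +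
      relSum δ a +
      ENNReal.ofReal (Real.log (K / δ)) * tailSum ε f := by
  have hK : 0 < K := hδ.trans_le hδK
  have pointwise : ∀ k m n, w k m n * ENNReal.ofReal (Real.log (ε / f m)) ≤
      w k m n * ENNReal.ofReal (Real.log (ε / g n)) +
      ENNReal.ofReal (g n) * ENNReal.ofReal (a k) / ENNReal.ofReal K *
        (w k m n / ENNReal.ofReal (f m)) +
      w k m n * ENNReal.ofReal (Real.log (δ / a k)) +
      w k m n * ENNReal.ofReal (if f m < ε then Real.log (K / δ) else 0) := by
    intro k m n
    rcases eq_or_ne (w k m n) 0 with h0 | h0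
    · simp [h0]
    have hfm : 0 < f m := by
      rw [← ENNReal.ofReal_pos, ← hf m]
      exact (pos_iff_ne_zero.2 h0).trans_le
        ((ENNReal.le_tsum n).trans (ENNReal.le_tsum (f := fun k => ∑' n, w k m n) k))
    have hgn : 0 < g n := by
      rw [← ENNReal.ofReal_pos, ← hg n]
      exact (pos_iff_ne_zero.2 h0).trans_le ((ENNReal.le_tsum (f := fun m => w k m n) m).trans
        (ENNReal.le_tsum (f := fun k => ∑' m, w k m n) k))
    have hak : 0 < a k := by
      rw [← ENNReal.ofReal_pos]
      exact (pos_iff_ne_zero.2 h0).trans_le (((ENNReal.le_tsum n).trans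
        (ENNReal.le_tsum (f := fun m => ∑' n, w k m n) m)).trans (ha k))
    have h := mul_le_mul_right (log_div_le_add_of_pos hak hfm hgn hδ hδK hε) (w k m n)
    refine h.trans (le_of_eq ?_)
    rw [mul_add, mul_add, mul_add]
    congr 3
    rw [ENNReal.ofReal_div_of_pos (by positivity), ENNReal.ofReal_mul hgn.le,
      ENNReal.ofReal_mul hfm.le, ENNReal.div_eq_inv_mul, ENNReal.mul_inv (Or.inr (by simp))
      (Or.inr (by simpa using hK)), ENNReal.div_eq_inv_mul, ENNReal.div_eq_inv_mul]
    ring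
  have hfsum : relSum ε f = ∑' k, ∑' m, ∑' n, w k m n * ENNReal.ofReal (Real.log (ε / f m)) := by
    rw [ENNReal.tsum_comm]
    refine tsum_congr fun m => ?_
    simp only [ENNReal.tsum_mul_right]
    rw [hf m, ENNReal.ofReal_mul (hf0 m)]
  have hgsum : ∑' k, ∑' m, ∑' n, w k m n * ENNReal.ofReal (Real.log (ε / g n)) = relSum ε g := by
    have : ∀ k, ∑' m, ∑' n, w k m n * ENNReal.ofReal (Real.log (ε / g n)) =
        ∑' n, ∑' m, w k m n * ENNReal.ofReal (Real.log (ε / g n)) := fun k => ENNReal.tsum_comm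
    simp only [this]
    rw [ENNReal.tsum_comm]
    refine tsum_congr fun n => ?_
    simp only [ENNReal.tsum_mul_right]
    rw [hg n, ENNReal.ofReal_mul (hg0 n)]
  have hQ : ∑' k, ∑' m, ∑' n, ENNReal.ofReal (g n) * ENNReal.ofReal (a k) / ENNReal.ofReal K *
        (w k m n / ENNReal.ofReal (f m)) ≤
      (∑' n, ENNReal.ofReal (g n)) * (∑' k, ENNReal.ofReal (a k)) / ENNReal.ofReal K := by
    have h1 : ∀ k, ∑' m, ∑' n, ENNReal.ofReal (g n) * ENNReal.ofReal (a k) / ENNReal.ofReal K *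
        (w k m n / ENNReal.ofReal (f m)) ≤
        ∑' n, ENNReal.ofReal (g n) * ENNReal.ofReal (a k) / ENNReal.ofReal K := by
      intro k
      rw [ENNReal.tsum_comm]
      refine ENNReal.tsum_le_tsum fun n => ?_
      rw [ENNReal.tsum_mul_left]
      exact mul_le_of_le_one_right' (hw k n)
    refine (ENNReal.tsum_le_tsum h1).trans (le_of_eq ?_)
    simp only [div_eq_mul_inv, ENNReal.tsum_mul_right, ENNReal.tsum_mul_left]
  have hasum : ∑' k, ∑' m, ∑' n, w k m n * ENNReal.ofReal (Real.log (δ / a k)) ≤ relSum δ a := by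
    refine ENNReal.tsum_le_tsum fun k => ?_
    simp only [ENNReal.tsum_mul_right]
    rw [ENNReal.ofReal_mul (ha0 k)]
    exact mul_le_mul_left (ha k) _
  have htail : ∑' k, ∑' m, ∑' n,
        w k m n * ENNReal.ofReal (if f m < ε then Real.log (K / δ) else 0) =
      ENNReal.ofReal (Real.log (K / δ)) * tailSum ε f := by
    rw [tailSum, ENNReal.tsum_comm, ← ENNReal.tsum_mul_left]
    refine tsum_congr fun m => ?_
    simp only [ENNReal.tsum_mul_right]
    rw [hf m]
    split_ifs
    · rw [mul_comm]
    · simp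
  rw [hfsum]
  calc _ ≤ ∑' k, ∑' m, ∑' n, (w k m n * ENNReal.ofReal (Real.log (ε / g n)) +
      ENNReal.ofReal (g n) * ENNReal.ofReal (a k) / ENNReal.ofReal K *
        (w k m n / ENNReal.ofReal (f m)) +
      w k m n * ENNReal.ofReal (Real.log (δ / a k)) +
      w k m n * ENNReal.ofReal (if f m < ε then Real.log (K / δ) else 0)) :=
        ENNReal.tsum_le_tsum fun k => ENNReal.tsum_le_tsum fun m =>
          ENNReal.tsum_le_tsum fun n => pointwise k m n
    _ ≤ _ := by
        simp only [ENNReal.tsum_add]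
        rw [htail, hgsum]
        gcongr

end Sums

section Eigenbasis

variable {E : Type*} [NormedAddCommGroup E] [InnerProductSpace ℂ E] {ι κ : Type*}

theorem inner_mul_inner_symm_eq (x y : E) :
    (inner ℂ y x * inner ℂ x y : ℂ) = ((‖(inner ℂ x y : ℂ)‖ ^ 2 : ℝ) : ℂ) := by
  rw [← inner_conj_symm y x, Complex.conj_mul']
  norm_cast

theorem _root_.HilbertBasis.hasSum_norm_inner_sq (b : HilbertBasis ι ℂ E) (z : E) :
    HasSum (fun i => ‖(inner ℂ (b i) z : ℂ)‖ ^ 2) (‖z‖ ^ 2) := by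
  have h := (b.hasSum_inner_mul_inner z z).mapL Complex.reCLM
  simp only [inner_mul_inner_symm_eq, inner_self_eq_norm_sq_to_K, Complex.reCLM_apply,
    Complex.ofReal_re] at h
  convert h using 1
  norm_cast

theorem _root_.HilbertBasis.tsum_ofReal_norm_inner_sq (b : HilbertBasis ι ℂ E) (z : E) :
    ∑' i, ENNReal.ofReal (‖(inner ℂ (b i) z : ℂ)‖ ^ 2) = ENNReal.ofReal (‖z‖ ^ 2) := by
  have h := b.hasSum_norm_inner_sq z
  rw [← h.tsum_eq, ENNReal.ofReal_tsum_of_nonneg (fun _ => by positivity) h.summable]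

theorem qf_sub (A B : E →L[ℂ] E) (x : E) : qf (A - B) x = qf A x - qf B x := by
  rw [qf, qf, qf, sub_apply, inner_sub_right, Complex.sub_re]

variable {A : E →L[ℂ] E} {e : HilbertBasis ι ℂ E} {a : ι → ℝ}

theorem IsEigenbasis.hasSum_apply (h : IsEigenbasis A e a) (z : E) :
    HasSum (fun k => ((a k : ℂ) * inner ℂ (e k) z) • e k) (A z) := by
  refine ((e.hasSum_repr z).mapL A).congr_fun fun k => ?_
  rw [map_smul, h k, smul_smul, mul_comm, e.repr_apply_apply]

theorem IsEigenbasis.hasSum_inner (h : IsEigenbasis A e a) (y z : E) :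
    HasSum (fun k => (a k : ℂ) * (inner ℂ y (e k) * inner ℂ (e k) z)) (inner ℂ y (A z)) := by
  refine ((h.hasSum_apply z).mapL (innerSL ℂ y)).congr_fun fun k => ?_
  rw [map_smul, innerSL_apply_apply, smul_eq_mul]
  ring

theorem IsEigenbasis.hasSum_qf (h : IsEigenbasis A e a) (z : E) :
    HasSum (fun k => ‖(inner ℂ (e k) z : ℂ)‖ ^ 2 * a k) (qf A z) := by
  refine ((h.hasSum_inner z z).mapL Complex.reCLM).congr_fun fun k => ?_
  rw [inner_mul_inner_symm_eq, Complex.reCLM_apply, ← Complex.ofReal_mul, Complex.ofReal_re,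
    mul_comm]

theorem IsEigenbasis.inner_self (h : IsEigenbasis A e a) (k : ι) :
    (inner ℂ (e k) (A (e k)) : ℂ) = a k := by
  rw [h k, inner_smul_right, inner_self_eq_norm_sq_to_K, e.orthonormal.1 k]
  simp

theorem IsEigenbasis.qf_apply (h : IsEigenbasis A e a) (k : ι) : qf A (e k) = a k := by
  rw [qf, h.inner_self, Complex.ofReal_re]

theorem IsEigenbasis.tsum_ofReal_abs_le (h : IsEigenbasis A e a) :
    ∑' k, ENNReal.ofReal |a k| ≤ traceNorm A := by
  refine le_trans (le_of_eq (tsum_congr fun k => ?_))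
    (tsum_inner_le_traceNorm A e.orthonormal e.orthonormal)
  rw [h.inner_self, Complex.norm_real, Real.norm_eq_abs]

theorem tsum_ofReal_abs_qf_le (A : E →L[ℂ] E) (b : HilbertBasis κ ℂ E) :
    ∑' k, ENNReal.ofReal |qf A (b k)| ≤ traceNorm A := by
  refine le_trans (ENNReal.tsum_le_tsum fun k => ENNReal.ofReal_le_ofReal ?_)
    (tsum_inner_le_traceNorm A b.orthonormal b.orthonormal)
  exact Complex.abs_re_le_norm _

theorem IsEigenbasis.ofReal_qf (h : IsEigenbasis A e a) (ha : ∀ k, 0 ≤ a k) (z : E) :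
    ENNReal.ofReal (qf A z) =
      ∑' k, ENNReal.ofReal (‖(inner ℂ (e k) z : ℂ)‖ ^ 2) * ENNReal.ofReal (a k) := by
  have hs := h.hasSum_qf z
  rw [← hs.tsum_eq, ENNReal.ofReal_tsum_of_nonneg
    (fun k => mul_nonneg (by positivity) (ha k)) hs.summable]
  exact tsum_congr fun k => ENNReal.ofReal_mul (by positivity)

theorem IsEigenbasis.tsum_ofReal_qf (h : IsEigenbasis A e a) (ha : ∀ k, 0 ≤ a k)
    (b : HilbertBasis κ ℂ E) :
    ∑' j, ENNReal.ofReal (qf A (b j)) = ∑' k, ENNReal.ofReal (a k) := by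
  simp only [h.ofReal_qf ha]
  rw [ENNReal.tsum_comm]
  refine tsum_congr fun k => ?_
  rw [ENNReal.tsum_mul_right]
  simp only [norm_inner_symm (e k)]
  rw [b.tsum_ofReal_norm_inner_sq, e.orthonormal.1 k]
  simp

theorem IsEigenbasis.tsum_ofReal_le_of_le_affine (h : IsEigenbasis A e a)
    (b : HilbertBasis κ ℂ E) {φ : ℝ → ℝ} {r c d : κ → ℝ} (hφ : ∀ l, 0 ≤ φ (a l))
    (hle : ∀ k l, (inner ℂ (e l) (b k) : ℂ) ≠ 0 → φ (a l) ≤ r k + c k * (a l - d k)) :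
    ∑' l, ENNReal.ofReal (φ (a l)) ≤ ∑' k, ENNReal.ofReal (r k + c k * (qf A (b k) - d k)) := by
  have h1 : ∀ l, ENNReal.ofReal (φ (a l)) =
      ∑' k, ENNReal.ofReal (‖(inner ℂ (e l) (b k) : ℂ)‖ ^ 2) * ENNReal.ofReal (φ (a l)) := by
    intro l
    rw [ENNReal.tsum_mul_right]
    simp only [norm_inner_symm (e l)]
    rw [b.tsum_ofReal_norm_inner_sq, e.orthonormal.1 l]
    simp
  rw [tsum_congr h1, ENNReal.tsum_comm]
  refine ENNReal.tsum_le_tsum fun k => ?_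
  refine tsum_ofReal_mul_le_of_le_affine (fun l => by positivity) ?_ (h.hasSum_qf (b k)) hφ
    fun l hl => hle k l (by simpa using hl)
  have := e.hasSum_norm_inner_sq (b k)
  rwa [b.orthonormal.1 k, one_pow] at this

theorem mul_log_div_le {X x y : ℝ} (hX : 0 < X) (hx : 0 ≤ x) (hy : 0 < y) :
    x * Real.log (X / x) ≤ y * Real.log (X / y) + (Real.log (X / y) - 1) * (x - y) := by
  rcases hx.eq_or_lt with rfl | hx
  · simp only [zero_mul, zero_sub]
    nlinarith
  have h := mul_le_mul_of_nonneg_left (Real.log_le_sub_one_of_pos (div_pos hy hx)) hx.le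
  rw [mul_sub, mul_div_cancel₀ _ hx.ne'] at h
  rw [Real.log_div hX.ne' hx.ne', Real.log_div hX.ne' hy.ne']
  rw [Real.log_div hy.ne' hx.ne'] at h
  linarith

theorem IsEigenbasis.relSum_le (h : IsEigenbasis A e a) (ha : ∀ k, 0 ≤ a k) {X : ℝ}
    (hX : ∀ k, a k ≤ X) (b : HilbertBasis κ ℂ E) :
    relSum X a ≤ relSum X fun k => qf A (b k) := by
  have hqf : ∀ k, 0 ≤ qf A (b k) := fun k =>
    (h.hasSum_qf (b k)).nonneg fun l => mul_nonneg (by positivity) (ha l)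
  refine (h.tsum_ofReal_le_of_le_affine b (φ := fun x => x * Real.log (X / x))
    (r := fun k => qf A (b k) * Real.log (X / qf A (b k)))
    (c := fun k => Real.log (X / qf A (b k)) - 1) (d := fun k => qf A (b k)) (fun l => ?_)
    fun k l hkl => ?_).trans (le_of_eq ?_)
  · rcases (ha l).eq_or_lt with h0 | h0
    · simp [← h0]
    · exact mul_nonneg h0.le (Real.log_nonneg ((one_le_div h0).2 (hX l)))
  · rcases (ha l).eq_or_lt with h0 | h0
    · rcases (hqf k).eq_or_lt with h1 | h1
      · simp [← h0, ← h1]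
      · simp only [← h0, zero_mul, zero_sub]
        nlinarith
    · have h1 : 0 < qf A (b k) := by
        refine lt_of_lt_of_le (mul_pos (pow_pos (norm_pos_iff.2 hkl) 2) h0)
          (le_hasSum (h.hasSum_qf (b k)) l fun j _ => mul_nonneg (by positivity) (ha j))
      exact mul_log_div_le (h0.trans_le (hX l)) h0.le h1
  · simp [relSum]

theorem mul_log_div_max_le {M ε x y : ℝ} (hM : 0 < M) (hε : 0 < ε) (hx : 0 ≤ x) (hy : 0 ≤ y) :
    x * Real.log (M / max x ε) ≤ y * Real.log (M / max y ε) +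
      (if y < ε then Real.log (M / ε) else Real.log (M / y) - 1) * (x - y) := by
  have hm : 0 < max x ε := lt_max_of_lt_right hε
  split_ifs with hyε
  · have h := Real.log_le_log (div_pos hM hm)
      (div_le_div_of_nonneg_left hM.le hε (le_max_right x ε))
    rw [max_eq_right hyε.le]
    nlinarith
  · have hy0 : 0 < y := hε.trans_le (not_lt.1 hyε)
    rw [max_eq_left (not_lt.1 hyε)]
    have h := mul_le_mul_of_nonneg_left (Real.log_le_sub_one_of_pos (div_pos hy0 hm)) hx
    have h2 : x * (y / max x ε) ≤ y := by
      rw [mul_div_left_comm]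
      exact mul_le_of_le_one_right hy (div_le_one_of_le₀ (le_max_left _ _) hm.le)
    rw [Real.log_div hM.ne' hm.ne', Real.log_div hM.ne' hy0.ne']
    rw [Real.log_div hy0.ne' hm.ne'] at h
    linarith

theorem IsEigenbasis.cutSum_le {A' : E →L[ℂ] E} {e' : HilbertBasis κ ℂ E} {a' : κ → ℝ}
    (h : IsEigenbasis A e a) (h' : IsEigenbasis A' e' a') (ha : ∀ k, 0 ≤ a k)
    (ha' : ∀ k, 0 ≤ a' k) {M ε : ℝ} (haM : ∀ k, a k ≤ M) (haM' : ∀ k, a' k ≤ M) (hε : 0 < ε)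
    (hεM : ε ≤ M) :
    cutSum M ε a ≤ cutSum M ε a' + ENNReal.ofReal (Real.log (M / ε) + 1) *
      ∑' k, ENNReal.ofReal |qf (A - A') (e' k)| := by
  have hM : 0 < M := hε.trans_le hεM
  refine (h.tsum_ofReal_le_of_le_affine e' (φ := fun x => x * Real.log (M / max x ε))
    (r := fun k => a' k * Real.log (M / max (a' k) ε))
    (c := fun k => if a' k < ε then Real.log (M / ε) else Real.log (M / a' k) - 1)
    (d := a') (fun l => mul_nonneg (ha l) ?_)
    fun k l _ => mul_log_div_max_le hM hε (ha l) (ha' k)).trans ?_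
  · exact Real.log_nonneg ((one_le_div (lt_max_of_lt_right hε)).2 (max_le (haM l) hεM))
  rw [← ENNReal.tsum_mul_left, cutSum, ← ENNReal.tsum_add]
  refine ENNReal.tsum_le_tsum fun k => ENNReal.ofReal_add_le.trans (add_le_add le_rfl ?_)
  have hlog : 0 ≤ Real.log (M / ε) := Real.log_nonneg ((one_le_div hε).2 hεM)
  rw [← ENNReal.ofReal_mul (by linarith)]
  refine ENNReal.ofReal_le_ofReal ((le_abs_self _).trans ?_)
  rw [abs_mul, qf_sub, h'.qf_apply k]
  refine mul_le_mul_of_nonneg_right ?_ (abs_nonneg _)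
  split_ifs with hlt
  · rw [abs_of_nonneg hlog]
    linarith
  · have hk : 0 < a' k := hε.trans_le (not_lt.1 hlt)
    have h1 : 0 ≤ Real.log (M / a' k) := Real.log_nonneg ((one_le_div hk).2 (haM' k))
    have h2 := Real.log_le_log (div_pos hM hk)
      (div_le_div_of_nonneg_left hM.le hε (not_lt.1 hlt))
    rw [abs_le]
    constructor <;> linarith

end Eigenbasis

section Entropy

variable {E : Type*} [NormedAddCommGroup E] [InnerProductSpace ℂ E]

theorem _root_.HilbertBasis.isONB {s : Set E} {b : HilbertBasis s ℂ E}
    (hb : ⇑b = ((↑) : s → E)) : IsONB s := by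
  refine ⟨hb ▸ b.orthonormal, ?_⟩
  have h := b.dense_span
  rw [hb, Subtype.range_coe] at h
  rwa [Submodule.dense_iff_topologicalClosure_eq_top]

variable [CompleteSpace E]

theorem IsONB.exists_hilbertBasis {s : Set E} (hs : IsONB s) :
    ∃ b : HilbertBasis s ℂ E, ⇑b = ((↑) : s → E) := by
  refine ⟨HilbertBasis.mk hs.1 ?_, HilbertBasis.coe_mk _ _⟩
  rw [Subtype.range_coe, Submodule.dense_iff_topologicalClosure_eq_top.1 hs.2]

theorem IsEigenbasis.qEntropy_eq {A : E →L[ℂ] E} {s : Set E} {e : HilbertBasis s ℂ E}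
    {a : s → ℝ} (h : IsEigenbasis A e a) (he : ⇑e = ((↑) : s → E)) (ha : ∀ k, 0 ≤ a k) {X : ℝ}
    (hX : HasSum a X) : qEntropy A = relSum X a := by
  refine le_antisymm ((iInf₂_le s (HilbertBasis.isONB he)).trans (le_of_eq ?_))
    (le_iInf₂ fun t ht => ?_)
  · rw [← clEntropy_eq_relSum ha hX]
    congr 1
    funext v
    rw [← h.qf_apply v, he]
  · obtain ⟨b, hb⟩ := ht.exists_hilbertBasis
    have hqf : ∀ v : t, 0 ≤ qf A v := fun v =>
      (h.hasSum_qf v).nonneg fun l => mul_nonneg (by positivity) (ha l)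
    have hsum : HasSum (fun v : t => qf A v) X := by
      have h1 := h.tsum_ofReal_qf ha b
      rw [hb, ← ENNReal.ofReal_tsum_of_nonneg ha hX.summable, hX.tsum_eq] at h1
      exact hasSum_of_tsum_ofReal_eq hqf (hX.nonneg ha) h1
    rw [clEntropy_eq_relSum hqf hsum]
    have := h.relSum_le ha (fun k => le_hasSum hX k fun j _ => ha j) b
    rwa [hb] at this

end Entropy

section Kraus

variable {ι κ θ : Type*}

theorem summable_of_tsum_ofReal_ne_top {x : ι → ℝ} (hx : ∀ i, 0 ≤ x i)
    (h : ∑' i, ENNReal.ofReal (x i) ≠ ∞) : Summable x :=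
  (ENNReal.summable_toReal h).congr fun i => ENNReal.toReal_ofReal (hx i)

theorem ofReal_eq_tsum_mul {c s : ι → ℝ} {q : ℝ} (hc : ∀ k, 0 ≤ c k) (hs : ∀ k, 0 ≤ s k)
    (h : HasSum (fun k => c k * s k) q) :
    ENNReal.ofReal q = ∑' k, ENNReal.ofReal (c k) * ENNReal.ofReal (s k) := by
  rw [← h.tsum_eq, ENNReal.ofReal_tsum_of_nonneg (fun k => mul_nonneg (hc k) (hs k)) h.summable]
  exact tsum_congr fun k => ENNReal.ofReal_mul (hc k)

theorem ofReal_abs_le_tsum_mul {c s : ι → ℝ} {q : ℝ} (hs : ∀ k, 0 ≤ s k)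
    (h : HasSum (fun k => c k * s k) q) :
    ENNReal.ofReal |q| ≤ ∑' k, ENNReal.ofReal |c k| * ENNReal.ofReal (s k) := by
  have h1 : HasSum (fun k => |c k| * s k) (∑' k, |c k| * s k) := by
    refine (h.summable.abs.congr fun k => ?_).hasSum
    rw [abs_mul, abs_of_nonneg (hs k)]
  rw [← ofReal_eq_tsum_mul (fun k => abs_nonneg _) hs h1]
  refine ENNReal.ofReal_le_ofReal (h.norm_le_of_bounded h1 fun k => le_of_eq ?_)
  rw [Real.norm_eq_abs, abs_mul, abs_of_nonneg (hs k)]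

variable {E F G : Type*}
variable [NormedAddCommGroup E] [InnerProductSpace ℂ E]
variable [NormedAddCommGroup F] [InnerProductSpace ℂ F]
variable [NormedAddCommGroup G] [InnerProductSpace ℂ G]

theorem IsEigenbasis.summable {C : E →L[ℂ] E} {e : HilbertBasis ι ℂ E} {c : ι → ℝ}
    (h : IsEigenbasis C e c) (hC : IsTC C) : Summable c :=
  (summable_of_tsum_ofReal_ne_top (fun k => abs_nonneg (c k))
    (ne_top_of_le_ne_top hC h.tsum_ofReal_abs_le)).of_abs

theorem IsEigenbasis.tsum_div_le_one {B : G →L[ℂ] G} {γ : HilbertBasis θ ℂ G} {g : θ → ℝ}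
    (h : IsEigenbasis B γ g) (hg : ∀ n, 0 ≤ g n) {a : ℝ} (ha : 0 ≤ a) {y : G}
    (hy : ∀ z, a * ‖(inner ℂ z y : ℂ)‖ ^ 2 ≤ qf B z) :
    ∑' n, ENNReal.ofReal (a * ‖(inner ℂ (γ n) y : ℂ)‖ ^ 2) / ENNReal.ofReal (g n) ≤ 1 := by
  have hterm : ∀ n, ENNReal.ofReal (a * ‖(inner ℂ (γ n) y : ℂ)‖ ^ 2) / ENNReal.ofReal (g n) =
      ENNReal.ofReal (a * (‖(inner ℂ (γ n) y : ℂ)‖ ^ 2 / g n)) := by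
    intro n
    rcases (hg n).eq_or_lt with h0 | h0
    · have h1 : a * ‖(inner ℂ (γ n) y : ℂ)‖ ^ 2 = 0 := by
        refine le_antisymm ((hy (γ n)).trans ?_) (by positivity)
        rw [h.qf_apply, ← h0]
      simp [h1, ← h0]
    · rw [← ENNReal.ofReal_div_of_pos h0, mul_div_assoc]
  simp only [hterm]
  rw [ENNReal.tsum_eq_iSup_sum]
  refine iSup_le fun s => ?_
  rw [← ENNReal.ofReal_sum_of_nonneg fun n _ => mul_nonneg ha (div_nonneg (by positivity) (hg n)),
    ← Finset.mul_sum]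
  set S := ∑ n ∈ s, ‖(inner ℂ (γ n) y : ℂ)‖ ^ 2 / g n with hS
  have hS0 : 0 ≤ S := Finset.sum_nonneg fun n _ => div_nonneg (by positivity) (hg n)
  let z : G := ∑ n ∈ s, ((inner ℂ (γ n) y : ℂ) / (g n : ℂ)) • γ n
  have hzy : (inner ℂ z y : ℂ) = (S : ℂ) := by
    rw [sum_inner, hS, Complex.ofReal_sum]
    refine Finset.sum_congr rfl fun n _ => ?_
    rw [inner_smul_left, map_div₀, Complex.conj_ofReal, div_mul_eq_mul_div, Complex.conj_mul']
    push_cast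
    rfl
  have hBz : qf B z = S := by
    have h1 : B z = ∑ n ∈ s, ((inner ℂ (γ n) y : ℂ) / (g n : ℂ) * (g n : ℂ)) • γ n := by
      rw [map_sum]
      refine Finset.sum_congr rfl fun n _ => ?_
      rw [map_smul, h n, smul_smul]
    rw [qf, h1, γ.orthonormal.inner_sum, Complex.re_sum]
    refine Finset.sum_congr rfl fun n _ => ?_
    rw [map_div₀, Complex.conj_ofReal, ← mul_assoc, div_mul_div_comm, Complex.conj_mul',
      div_mul_eq_mul_div]
    norm_cast
    rcases (hg n).eq_or_lt with h0 | h0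
    · simp [← h0]
    · field_simp
  have h2 := hy z
  rw [hzy, hBz, Complex.norm_real, Real.norm_eq_abs, sq_abs] at h2
  rw [ENNReal.ofReal_le_one]
  rcases hS0.eq_or_lt with h0 | h0
  · simp [← h0]
  · nlinarith

/-- The vector `∑ᵢ ⟪γ, bᵢ⟫ Vᵢ z`, the contraction with `γ` of the Stinespring image of `z`. -/
def compVec (V : ℕ → (E →L[ℂ] F)) (b : HilbertBasis ℕ ℂ G) (γ : G) (z : E) : F :=
  ∑' i, (inner ℂ γ (b i) : ℂ) • V i z

variable [CompleteSpace E] [CompleteSpace F]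

theorem KrausTNI.tsum_ofReal_le {V : ℕ → (E →L[ℂ] F)} (hV : KrausTNI V) (z : E) :
    ∑' i, ENNReal.ofReal (‖V i z‖ ^ 2) ≤ ENNReal.ofReal (‖z‖ ^ 2) := by
  refine ENNReal.tsum_le_of_sum_range_le fun n => ?_
  rw [← ENNReal.ofReal_sum_of_nonneg fun i _ => by positivity]
  refine ENNReal.ofReal_le_ofReal ?_
  have h := (hV n).re_inner_nonneg_right z
  rw [sub_apply, inner_sub_right, map_sub, sum_apply, inner_sum, map_sum] at h
  simp only [ContinuousLinearMap.comp_apply, ContinuousLinearMap.adjoint_inner_right,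
    inner_self_eq_norm_sq, one_apply_eq_self] at h
  linarith

theorem KrausTNI.summable {V : ℕ → (E →L[ℂ] F)} (hV : KrausTNI V) (z : E) :
    Summable fun i => ‖V i z‖ ^ 2 :=
  summable_of_tsum_ofReal_ne_top (fun _ => by positivity)
    (ne_top_of_le_ne_top ENNReal.ofReal_ne_top (hV.tsum_ofReal_le z))

theorem KrausTNI.summable_norm_inner_sq {V : ℕ → (E →L[ℂ] F)} (hV : KrausTNI V) (z : E) (φ : F) :
    Summable fun i => ‖(inner ℂ φ (V i z) : ℂ)‖ ^ 2 := by
  refine ((hV.summable z).mul_left (‖φ‖ ^ 2)).of_nonneg_of_le (fun i => by positivity) fun i => ?_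
  rw [← mul_pow]
  exact pow_le_pow_left₀ (norm_nonneg _) (norm_inner_le_norm _ _) 2

theorem KrausTNI.hasSum_compVec {V : ℕ → (E →L[ℂ] F)} (hV : KrausTNI V) (b : HilbertBasis ℕ ℂ G)
    (γ : G) (z : E) : HasSum (fun i => (inner ℂ γ (b i) : ℂ) • V i z) (compVec V b γ z) := by
  refine Summable.hasSum (Summable.of_norm_bounded
    ((b.hasSum_norm_inner_sq γ).summable.add (hV.summable z)) fun i => ?_)
  rw [norm_smul, norm_inner_symm]
  nlinarith [sq_nonneg (‖(inner ℂ (b i) γ : ℂ)‖ - ‖V i z‖), sq_nonneg ‖V i z‖,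
    sq_nonneg ‖(inner ℂ (b i) γ : ℂ)‖]

/-- The partial contraction of the Stinespring image of `z` with a vector of the output space. -/
theorem KrausTNI.exists_inner_compVec {V : ℕ → (E →L[ℂ] F)} (hV : KrausTNI V)
    (b : HilbertBasis ℕ ℂ G) (φ : F) (z : E) :
    ∃ y : G, (∀ γ, (inner ℂ φ (compVec V b γ z) : ℂ) = inner ℂ γ y) ∧
      HasSum (fun i => ‖(inner ℂ φ (V i z) : ℂ)‖ ^ 2) (‖y‖ ^ 2) := by
  have hmem : Memℓp (fun i => (inner ℂ φ (V i z) : ℂ)) 2 := by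
    refine memℓp_gen ?_
    simpa using hV.summable_norm_inner_sq z φ
  let y : G := b.repr.symm ⟨_, hmem⟩
  have hy : ∀ i, (inner ℂ (b i) y : ℂ) = inner ℂ φ (V i z) := fun i => by
    rw [← b.repr_apply_apply, LinearIsometryEquiv.apply_symm_apply]
  refine ⟨y, fun γ => ?_, by simpa only [hy] using b.hasSum_norm_inner_sq y⟩
  have h1 := (hV.hasSum_compVec b γ z).mapL (innerSL ℂ φ)
  refine h1.unique ((b.hasSum_inner_mul_inner γ y).congr_fun fun i => ?_)
  rw [map_smul, innerSL_apply_apply, smul_eq_mul, hy]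

theorem KrausTNI.tsum_ofReal_norm_inner_compVec {V : ℕ → (E →L[ℂ] F)} (hV : KrausTNI V)
    (b : HilbertBasis ℕ ℂ G) (γ : HilbertBasis θ ℂ G) (φ : F) (z : E) :
    ∑' n, ENNReal.ofReal (‖(inner ℂ φ (compVec V b (γ n) z) : ℂ)‖ ^ 2) =
      ENNReal.ofReal (∑' i, ‖(inner ℂ φ (V i z) : ℂ)‖ ^ 2) := by
  obtain ⟨y, hy, hs⟩ := hV.exists_inner_compVec b φ z
  simp only [hy]
  rw [γ.tsum_ofReal_norm_inner_sq, hs.tsum_eq]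

theorem KrausTNI.tsum_ofReal_tsum_norm_inner_le {V : ℕ → (E →L[ℂ] F)} (hV : KrausTNI V)
    (φ : HilbertBasis κ ℂ F) (z : E) :
    ∑' m, ENNReal.ofReal (∑' i, ‖(inner ℂ (φ m) (V i z) : ℂ)‖ ^ 2) ≤
      ENNReal.ofReal (‖z‖ ^ 2) := by
  refine le_trans (le_of_eq ?_) (hV.tsum_ofReal_le z)
  simp only [ENNReal.ofReal_tsum_of_nonneg (fun i => sq_nonneg _)
    (hV.summable_norm_inner_sq z _)]
  rw [ENNReal.tsum_comm]
  exact tsum_congr fun i => φ.tsum_ofReal_norm_inner_sq _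

theorem KrausTNI.tsum_ofReal_norm_compVec_le {V : ℕ → (E →L[ℂ] F)} (hV : KrausTNI V)
    (b : HilbertBasis ℕ ℂ G) (γ : HilbertBasis θ ℂ G) (z : E) :
    ∑' n, ENNReal.ofReal (‖compVec V b (γ n) z‖ ^ 2) ≤ ENNReal.ofReal (‖z‖ ^ 2) := by
  obtain ⟨s, φ, -⟩ := exists_hilbertBasis ℂ F
  simp only [← φ.tsum_ofReal_norm_inner_sq]
  rw [ENNReal.tsum_comm]
  simp only [hV.tsum_ofReal_norm_inner_compVec b γ]
  exact hV.tsum_ofReal_tsum_norm_inner_le φ z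

end Kraus

section Complementary

variable {ι κ θ : Type*} {E F G : Type*}
variable [NormedAddCommGroup E] [InnerProductSpace ℂ E] [CompleteSpace E]
variable [NormedAddCommGroup F] [InnerProductSpace ℂ F] [CompleteSpace F]
variable [NormedAddCommGroup G] [InnerProductSpace ℂ G]
variable {V : ℕ → (E →L[ℂ] F)} {C : E →L[ℂ] E} {e : HilbertBasis ι ℂ E} {c : ι → ℝ}

theorem KrausTNI.summable_abs_mul (hV : KrausTNI V) (e : HilbertBasis ι ℂ E)
    (hc : Summable c) : Summable fun p : ι × ℕ => |c p.1| * ‖V p.2 (e p.1)‖ ^ 2 := by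
  refine summable_of_tsum_ofReal_ne_top (fun p => by positivity) ?_
  rw [ENNReal.tsum_prod' (f := fun p : ι × ℕ => ENNReal.ofReal (|c p.1| * ‖V p.2 (e p.1)‖ ^ 2))]
  have h1 : ∀ k, ∑' i, ENNReal.ofReal (|c k| * ‖V i (e k)‖ ^ 2) ≤ ENNReal.ofReal |c k| := by
    intro k
    simp only [ENNReal.ofReal_mul (abs_nonneg (c k))]
    rw [ENNReal.tsum_mul_left]
    refine mul_le_of_le_one_right' ((hV.tsum_ofReal_le (e k)).trans ?_)
    rw [e.orthonormal.1 k]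
    simp
  refine ne_top_of_le_ne_top ?_ (ENNReal.tsum_le_tsum h1)
  rw [← ENNReal.ofReal_tsum_of_nonneg (fun k => abs_nonneg (c k)) hc.abs]
  exact ENNReal.ofReal_ne_top

theorem KrausTNI.hasSum_krausMap (hV : KrausTNI V) (h : IsEigenbasis C e c) (hc : Summable c) :
    HasSum (fun i => V i ∘L C ∘L ContinuousLinearMap.adjoint (V i)) (krausMap V C) := by
  have hQ := ((Equiv.prodComm ℕ ι).summable_iff.2 (hV.summable_abs_mul e hc))
  refine (Summable.of_norm_bounded hQ.prod fun i => ?_).hasSum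
  have hQi : Summable fun k => |c k| * ‖V i (e k)‖ ^ 2 := hQ.prod_factor i
  refine ContinuousLinearMap.opNorm_le_bound _
    (tsum_nonneg fun k => mul_nonneg (abs_nonneg _) (sq_nonneg _)) fun y => ?_
  have h1 := (h.hasSum_apply (ContinuousLinearMap.adjoint (V i) y)).mapL (V i)
  refine h1.norm_le_of_bounded (hQi.hasSum.mul_right ‖y‖) fun k => ?_
  rw [map_smul, norm_smul, norm_mul, ContinuousLinearMap.adjoint_inner_right, Complex.norm_real,
    Real.norm_eq_abs]
  calc |c k| * ‖(inner ℂ (V i (e k)) y : ℂ)‖ * ‖V i (e k)‖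
      ≤ |c k| * (‖V i (e k)‖ * ‖y‖) * ‖V i (e k)‖ := by
        gcongr
        exact norm_inner_le_norm _ _
    _ = |c k| * ‖V i (e k)‖ ^ 2 * ‖y‖ := by ring

theorem KrausTNI.hasSum_qf_krausMap (hV : KrausTNI V) (h : IsEigenbasis C e c) (hc : Summable c)
    (φ : F) :
    HasSum (fun k => c k * ∑' i, ‖(inner ℂ φ (V i (e k)) : ℂ)‖ ^ 2) (qf (krausMap V C) φ) := by
  have hP : Summable fun p : ι × ℕ => c p.1 * ‖(inner ℂ φ (V p.2 (e p.1)) : ℂ)‖ ^ 2 := by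
    refine Summable.of_norm_bounded ((hV.summable_abs_mul e hc).mul_left (‖φ‖ ^ 2)) fun p => ?_
    rw [norm_mul, Real.norm_eq_abs, norm_pow, norm_norm]
    calc |c p.1| * ‖(inner ℂ φ (V p.2 (e p.1)) : ℂ)‖ ^ 2
        ≤ |c p.1| * (‖φ‖ * ‖V p.2 (e p.1)‖) ^ 2 := by
          gcongr
          exact norm_inner_le_norm _ _
      _ = ‖φ‖ ^ 2 * (|c p.1| * ‖V p.2 (e p.1)‖ ^ 2) := by ring
  have h1 : HasSum (fun i => qf C (ContinuousLinearMap.adjoint (V i) φ)) (qf (krausMap V C) φ) := by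
    refine ((((hV.hasSum_krausMap h hc).mapL (ContinuousLinearMap.apply ℂ F φ)).mapL
      (innerSL ℂ φ)).mapL Complex.reCLM).congr_fun fun i => ?_
    simp [qf, ContinuousLinearMap.adjoint_inner_left]
  have h2 : HasSum (fun i => qf C (ContinuousLinearMap.adjoint (V i) φ))
      (∑' p : ι × ℕ, c p.1 * ‖(inner ℂ φ (V p.2 (e p.1)) : ℂ)‖ ^ 2) := by
    refine ((Equiv.prodComm ℕ ι).hasSum_iff.2 hP.hasSum).prod_fiberwise fun i => ?_
    refine (h.hasSum_qf _).congr_fun fun k => ?_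
    simp [ContinuousLinearMap.adjoint_inner_right, norm_inner_symm φ, mul_comm]
  rw [h1.unique h2]
  exact hP.hasSum.prod_fiberwise fun k => (hV.summable_norm_inner_sq (e k) φ).hasSum.mul_left (c k)

theorem KrausTNI.norm_apply_le (hV : KrausTNI V) (i : ℕ) (z : E) : ‖V i z‖ ^ 2 ≤ ‖z‖ ^ 2 := by
  rw [← ENNReal.ofReal_le_ofReal_iff (by positivity)]
  exact (ENNReal.le_tsum i).trans (hV.tsum_ofReal_le z)

theorem KrausTNI.traceC_eq (hV : KrausTNI V) (h : IsEigenbasis C e c) (hc : Summable c)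
    (i j : ℕ) : traceC (V i ∘L C ∘L ContinuousLinearMap.adjoint (V j)) =
      ∑' k, (c k : ℂ) * inner ℂ (V j (e k)) (V i (e k)) := by
  obtain ⟨u, hu⟩ : ∃ u : HilbertBasis (stdONB F) ℂ F, ⇑u = ((↑) : stdONB F → F) :=
    (exists_isONB F).choose_spec.exists_hilbertBasis
  have hu' : ∀ v : stdONB F, (v : F) = u v := fun v => by rw [hu]
  let T : ι → stdONB F → ℂ := fun k v =>
    (c k : ℂ) * (inner ℂ (V j (e k)) (u v) * inner ℂ (u v) (V i (e k)))
  have hT : Summable (Function.uncurry T) := by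
    refine Summable.of_norm (summable_of_tsum_ofReal_ne_top (fun p => norm_nonneg _) ?_)
    rw [ENNReal.tsum_prod' (f := fun p => ENNReal.ofReal ‖Function.uncurry T p‖)]
    have h1 : ∀ k, ∑' v, ENNReal.ofReal ‖T k v‖ ≤ ENNReal.ofReal (|c k|) * 2 := by
      intro k
      have h2 : ∀ v, ENNReal.ofReal ‖T k v‖ ≤ ENNReal.ofReal |c k| *
          (ENNReal.ofReal (‖(inner ℂ (u v) (V j (e k)) : ℂ)‖ ^ 2) +
            ENNReal.ofReal (‖(inner ℂ (u v) (V i (e k)) : ℂ)‖ ^ 2)) := by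
        intro v
        rw [← ENNReal.ofReal_add (by positivity) (by positivity),
          ← ENNReal.ofReal_mul (abs_nonneg _)]
        refine ENNReal.ofReal_le_ofReal ?_
        rw [norm_mul, norm_mul, Complex.norm_real, Real.norm_eq_abs, norm_inner_symm (V j (e k))]
        refine mul_le_mul_of_nonneg_left ?_ (abs_nonneg _)
        nlinarith [sq_nonneg
            (‖(inner ℂ (u v) (V j (e k)) : ℂ)‖ - ‖(inner ℂ (u v) (V i (e k)) : ℂ)‖),
          sq_nonneg ‖(inner ℂ (u v) (V j (e k)) : ℂ)‖, sq_nonneg ‖(inner ℂ (u v) (V i (e k)) : ℂ)‖]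
      refine (ENNReal.tsum_le_tsum h2).trans ?_
      rw [ENNReal.tsum_mul_left, ENNReal.tsum_add, u.tsum_ofReal_norm_inner_sq,
        u.tsum_ofReal_norm_inner_sq]
      have h3 : ∀ i, ENNReal.ofReal (‖V i (e k)‖ ^ 2) ≤ 1 := fun i => by
        refine (ENNReal.ofReal_le_ofReal (hV.norm_apply_le i (e k))).trans ?_
        rw [e.orthonormal.1 k]
        simp
      exact mul_le_mul_right ((add_le_add (h3 j) (h3 i)).trans one_add_one_eq_two.le) _
    refine ne_top_of_le_ne_top ?_ (ENNReal.tsum_le_tsum h1)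
    rw [ENNReal.tsum_mul_right, ← ENNReal.ofReal_tsum_of_nonneg (fun k => abs_nonneg (c k)) hc.abs]
    exact ENNReal.mul_ne_top ENNReal.ofReal_ne_top (by simp)
  have h1 : traceC (V i ∘L C ∘L ContinuousLinearMap.adjoint (V j)) = ∑' v, ∑' k, T k v := by
    refine tsum_congr fun v => ?_
    rw [hu' v, ContinuousLinearMap.comp_apply, ContinuousLinearMap.comp_apply,
      ← ContinuousLinearMap.adjoint_inner_left, ← (h.hasSum_inner _ _).tsum_eq]
    refine tsum_congr fun k => ?_
    rw [ContinuousLinearMap.adjoint_inner_left, ContinuousLinearMap.adjoint_inner_right]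
    ring
  rw [h1, hT.tsum_comm]
  refine tsum_congr fun k => ?_
  rw [← (u.hasSum_inner_mul_inner _ _).tsum_eq, tsum_mul_left]

end Complementary

section ComplementaryPair

variable {ι κ θ : Type*} {E F G : Type*}
variable [NormedAddCommGroup E] [InnerProductSpace ℂ E] [CompleteSpace E]
variable [NormedAddCommGroup F] [InnerProductSpace ℂ F] [CompleteSpace F]
variable [NormedAddCommGroup G] [InnerProductSpace ℂ G]
variable {V : ℕ → (E →L[ℂ] F)} {c : ι → ℝ}

theorem KrausTNI.hasSum_qf_complementary (hV : KrausTNI V) (b : HilbertBasis ℕ ℂ G)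
    (e : HilbertBasis ι ℂ E) (hc : Summable c) {T : G →L[ℂ] G}
    (hT : ∀ i j, (inner ℂ (b i) (T (b j)) : ℂ) =
      ∑' k, (c k : ℂ) * inner ℂ (V j (e k)) (V i (e k))) (γ : G) :
    HasSum (fun k => c k * ‖compVec V b γ (e k)‖ ^ 2) (qf T γ) := by
  let S : ι → ℕ × ℕ → ℂ := fun k p => (c k : ℂ) *
    ((inner ℂ γ (b p.1) * inner ℂ (b p.2) γ) * inner ℂ (V p.2 (e k)) (V p.1 (e k)))
  have hS : Summable (Function.uncurry S) := by
    refine Summable.of_norm (summable_of_tsum_ofReal_ne_top (fun p => norm_nonneg _) ?_)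
    rw [ENNReal.tsum_prod' (f := fun p => ENNReal.ofReal ‖Function.uncurry S p‖)]
    let R : ℝ≥0∞ := ENNReal.ofReal (‖γ‖ ^ 2) + 1
    let s : ι → ℕ → ℝ≥0∞ := fun k i =>
      ENNReal.ofReal (‖(inner ℂ (b i) γ : ℂ)‖ * ‖V i (e k)‖)
    have hs : ∀ k, ∑' i, s k i ≤ R := by
      intro k
      have h1 : ∀ i, s k i ≤ ENNReal.ofReal (‖(inner ℂ (b i) γ : ℂ)‖ ^ 2) +
          ENNReal.ofReal (‖V i (e k)‖ ^ 2) := fun i => by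
        rw [← ENNReal.ofReal_add (by positivity) (by positivity)]
        refine ENNReal.ofReal_le_ofReal ?_
        nlinarith [sq_nonneg (‖(inner ℂ (b i) γ : ℂ)‖ - ‖V i (e k)‖), sq_nonneg ‖V i (e k)‖,
          sq_nonneg ‖(inner ℂ (b i) γ : ℂ)‖]
      refine (ENNReal.tsum_le_tsum h1).trans ?_
      rw [ENNReal.tsum_add, b.tsum_ofReal_norm_inner_sq]
      refine add_le_add le_rfl ((hV.tsum_ofReal_le (e k)).trans ?_)
      rw [e.orthonormal.1 k]
      simp
    have h1 : ∀ k, ∑' p, ENNReal.ofReal ‖S k p‖ ≤ ENNReal.ofReal |c k| * (R * R) := by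
      intro k
      have h2 : ∀ p : ℕ × ℕ,
          ENNReal.ofReal ‖S k p‖ ≤ ENNReal.ofReal |c k| * (s k p.1 * s k p.2) := by
        intro p
        rw [← ENNReal.ofReal_mul (by positivity), ← ENNReal.ofReal_mul (abs_nonneg _)]
        refine ENNReal.ofReal_le_ofReal ?_
        rw [norm_mul, norm_mul, norm_mul, Complex.norm_real, Real.norm_eq_abs,
          norm_inner_symm γ]
        refine mul_le_mul_of_nonneg_left ?_ (abs_nonneg _)
        calc _ ≤ ‖(inner ℂ (b p.1) γ : ℂ)‖ * ‖(inner ℂ (b p.2) γ : ℂ)‖ *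
              (‖V p.2 (e k)‖ * ‖V p.1 (e k)‖) := by
              gcongr
              exact norm_inner_le_norm _ _
          _ = _ := by ring
      refine (ENNReal.tsum_le_tsum h2).trans ?_
      rw [ENNReal.tsum_mul_left, ENNReal.tsum_prod' (f := fun p : ℕ × ℕ => s k p.1 * s k p.2)]
      simp only [ENNReal.tsum_mul_left, ENNReal.tsum_mul_right]
      gcongr
      · exact hs k
      · exact hs k
    refine ne_top_of_le_ne_top ?_ (ENNReal.tsum_le_tsum h1)
    rw [ENNReal.tsum_mul_right, ← ENNReal.ofReal_tsum_of_nonneg (fun k => abs_nonneg (c k)) hc.abs]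
    exact ENNReal.mul_ne_top ENNReal.ofReal_ne_top
      (ENNReal.mul_ne_top (by simp [R]) (by simp [R]))
  have hrow : ∀ k, HasSum (fun p => S k p) ((c k * ‖compVec V b γ (e k)‖ ^ 2 : ℝ) : ℂ) := by
    intro k
    have h1 := hV.hasSum_compVec b γ (e k)
    have hsk : Summable fun p => S k p := hS.prod_factor k
    have h2 : ∀ i, HasSum (fun j => S k (i, j)) ((c k : ℂ) *
        (inner ℂ γ (b i) * inner ℂ (compVec V b γ (e k)) (V i (e k)))) := by
      intro i
      have h3 := ((h1.mapL (innerSL ℂ (V i (e k)))).mapL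
        (Complex.conjCLE : ℂ →L[ℝ] ℂ)).mul_left ((c k : ℂ) * inner ℂ γ (b i))
      have h4 : (Complex.conjCLE : ℂ →L[ℝ] ℂ) (innerSL ℂ (V i (e k)) (compVec V b γ (e k))) =
          inner ℂ (compVec V b γ (e k)) (V i (e k)) := by simp
      rw [h4, mul_assoc] at h3
      refine h3.congr_fun fun j => ?_
      simp [S, mul_assoc]
    have h3 : HasSum (fun i => (c k : ℂ) *
        (inner ℂ γ (b i) * inner ℂ (compVec V b γ (e k)) (V i (e k))))
        ((c k : ℂ) * inner ℂ (compVec V b γ (e k)) (compVec V b γ (e k))) := by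
      refine ((h1.mapL (innerSL ℂ (compVec V b γ (e k)))).mul_left (c k : ℂ)).congr_fun fun i => ?_
      simp
    rw [inner_self_eq_norm_sq_to_K] at h3
    have h4 := (hsk.hasSum.prod_fiberwise h2).unique h3
    have h5 := hsk.hasSum
    rw [h4] at h5
    convert h5 using 1
    push_cast
    rfl
  have htot : HasSum (fun k => ((c k * ‖compVec V b γ (e k)‖ ^ 2 : ℝ) : ℂ))
      (inner ℂ γ (T γ)) := by
    have h1 := hS.hasSum.prod_fiberwise hrow
    have h2 : ∑' p, Function.uncurry S p = ∑' i, ∑' j, ∑' k, S k (i, j) := by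
      exact hS.tsum_prod.trans (hS.tsum_comm.symm.trans hS.prod_symm.prod.tsum_prod)
    have h3 : ∀ i, ∑' j, ∑' k, S k (i, j) = inner ℂ γ (b i) * inner ℂ (b i) (T γ) := by
      intro i
      have h4 := (((b.hasSum_repr γ).mapL T).mapL (innerSL ℂ (b i))).mul_left (inner ℂ γ (b i))
      rw [← innerSL_apply_apply ℂ (b i) (T γ), ← h4.tsum_eq]
      refine tsum_congr fun j => ?_
      rw [map_smul, map_smul, innerSL_apply_apply, hT, b.repr_apply_apply, smul_eq_mul, ← mul_assoc,
        ← tsum_mul_left]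
      refine tsum_congr fun k => ?_
      simp only [S]
      ring
    rw [h2, tsum_congr h3, (b.hasSum_inner_mul_inner γ (T γ)).tsum_eq] at h1
    exact h1
  exact (htot.mapL Complex.reCLM).congr_fun fun k => (Complex.ofReal_re _).symm

theorem tsum_ofReal_abs_le_of_hasSum {q : κ → ℝ} {s : κ → ι → ℝ} (hs : ∀ m k, 0 ≤ s m k)
    (h : ∀ m, HasSum (fun k => c k * s m k) (q m))
    (h1 : ∀ k, ∑' m, ENNReal.ofReal (s m k) ≤ 1) :
    ∑' m, ENNReal.ofReal |q m| ≤ ∑' k, ENNReal.ofReal |c k| := by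
  refine (ENNReal.tsum_le_tsum fun m => ofReal_abs_le_tsum_mul (hs m) (h m)).trans ?_
  rw [ENNReal.tsum_comm]
  refine ENNReal.tsum_le_tsum fun k => ?_
  rw [ENNReal.tsum_mul_left]
  exact mul_le_of_le_one_right' (h1 k)

variable [CompleteSpace G] {Φ : TraceMap E F} {Φt : TraceMap E G}

theorem IsComplementaryPair.tsum_abs_qf_le (hc : IsComplementaryPair Φ Φt) {C : E →L[ℂ] E}
    (hC : IsTC C) (hsymm : (C : E →ₗ[ℂ] E).IsSymmetric) (φ : HilbertBasis κ ℂ F) :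
    ∑' m, ENNReal.ofReal |qf (Φ.toFun C) (φ m)| ≤ traceNorm C := by
  obtain ⟨V, b, hV, hΦ, -⟩ := hc
  obtain ⟨t, e, c, -, h⟩ := hC.exists_isEigenbasis hsymm
  refine le_trans (tsum_ofReal_abs_le_of_hasSum
    (s := fun m k => ∑' i, ‖(inner ℂ (φ m) (V i (e k)) : ℂ)‖ ^ 2)
    (fun m k => tsum_nonneg fun i => by positivity) (fun m => ?_) fun k => ?_) h.tsum_ofReal_abs_le
  · rw [hΦ C hC]
    exact hV.hasSum_qf_krausMap h (h.summable hC) (φ m)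
  · refine (hV.tsum_ofReal_tsum_norm_inner_le φ (e k)).trans ?_
    rw [e.orthonormal.1 k]
    simp

theorem IsComplementaryPair.tsum_abs_qf_le' (hc : IsComplementaryPair Φ Φt) {C : E →L[ℂ] E}
    (hC : IsTC C) (hsymm : (C : E →ₗ[ℂ] E).IsSymmetric) (γ : HilbertBasis θ ℂ G) :
    ∑' n, ENNReal.ofReal |qf (Φt.toFun C) (γ n)| ≤ traceNorm C := by
  obtain ⟨V, b, hV, -, hΦt⟩ := hc
  obtain ⟨t, e, c, -, h⟩ := hC.exists_isEigenbasis hsymm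
  refine le_trans (tsum_ofReal_abs_le_of_hasSum (fun n k => sq_nonneg _)
    (fun n => hV.hasSum_qf_complementary b e (h.summable hC) (fun i j => ?_) (γ n))
    fun k => ?_) h.tsum_ofReal_abs_le
  · rw [hΦt C hC, hV.traceC_eq h (h.summable hC)]
  · refine (hV.tsum_ofReal_norm_compVec_le b γ (e k)).trans ?_
    rw [e.orthonormal.1 k]
    simp

/-- The weights `⟪φₘ ⊗ γₙ, V|eₖ⟩⟨eₖ|V* φₘ ⊗ γₙ⟫ aₖ` couple the spectra of the two outputs. -/
theorem IsComplementaryPair.exists_coupling (hc : IsComplementaryPair Φ Φt) {A : E →L[ℂ] E}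
    (hA : IsTC A) {e : HilbertBasis ι ℂ E} {a : ι → ℝ} (h : IsEigenbasis A e a)
    (ha : ∀ k, 0 ≤ a k) {φ : HilbertBasis κ ℂ F} {f : κ → ℝ} (hφ : IsEigenbasis (Φ.toFun A) φ f)
    (hf : ∀ m, 0 ≤ f m) {γ : HilbertBasis θ ℂ G} {g : θ → ℝ}
    (hγ : IsEigenbasis (Φt.toFun A) γ g) (hg : ∀ n, 0 ≤ g n) :
    ∃ w : ι → κ → θ → ℝ≥0∞,
      (∀ m, ∑' k, ∑' n, w k m n = ENNReal.ofReal (f m)) ∧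
      (∀ n, ∑' k, ∑' m, w k m n = ENNReal.ofReal (g n)) ∧
      (∀ k, ∑' m, ∑' n, w k m n ≤ ENNReal.ofReal (a k)) ∧
      (∀ k n, ∑' m, w k m n / ENNReal.ofReal (f m) ≤ 1) ∧
      ∀ k m, ∑' n, w k m n / ENNReal.ofReal (g n) ≤ 1 := by
  obtain ⟨V, b, hV, hΦ, hΦt⟩ := hc
  have hΦs : ∀ z, HasSum (fun k => a k * ∑' i, ‖(inner ℂ z (V i (e k)) : ℂ)‖ ^ 2)
      (qf (Φ.toFun A) z) := by
    rw [hΦ A hA]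
    exact hV.hasSum_qf_krausMap h (h.summable hA)
  have hΦts : ∀ z, HasSum (fun k => a k * ‖compVec V b z (e k)‖ ^ 2) (qf (Φt.toFun A) z) :=
    hV.hasSum_qf_complementary b e (h.summable hA) fun i j => by
      rw [hΦt A hA, hV.traceC_eq h (h.summable hA)]
  have hnn : ∀ z k, 0 ≤ ∑' i, ‖(inner ℂ z (V i (e k)) : ℂ)‖ ^ 2 :=
    fun z k => tsum_nonneg fun i => by positivity
  refine ⟨fun k m n => ENNReal.ofReal (a k * ‖(inner ℂ (φ m) (compVec V b (γ n) (e k)) : ℂ)‖ ^ 2),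
    fun m => ?_, fun n => ?_, fun k => ?_, fun k n => ?_, fun k m => ?_⟩
  · rw [← hφ.qf_apply m, ofReal_eq_tsum_mul ha (hnn (φ m)) (hΦs (φ m))]
    refine tsum_congr fun k => ?_
    simp only [ENNReal.ofReal_mul (ha k)]
    rw [ENNReal.tsum_mul_left, hV.tsum_ofReal_norm_inner_compVec b γ]
  · rw [← hγ.qf_apply n, ofReal_eq_tsum_mul ha (fun k => sq_nonneg _) (hΦts (γ n))]
    refine tsum_congr fun k => ?_
    simp only [ENNReal.ofReal_mul (ha k)]
    rw [ENNReal.tsum_mul_left, φ.tsum_ofReal_norm_inner_sq]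
  · simp only [ENNReal.ofReal_mul (ha k), ENNReal.tsum_mul_left,
      hV.tsum_ofReal_norm_inner_compVec b γ]
    refine mul_le_of_le_one_right' ((hV.tsum_ofReal_tsum_norm_inner_le φ (e k)).trans ?_)
    rw [e.orthonormal.1 k]
    simp
  · refine hφ.tsum_div_le_one hf (ha k) fun z => ?_
    obtain ⟨y, hy, hys⟩ := hV.exists_inner_compVec b z (e k)
    refine le_trans ?_ (le_hasSum (hΦs z) k fun l _ => mul_nonneg (ha l) (hnn z l))
    refine mul_le_mul_of_nonneg_left ?_ (ha k)
    rw [hys.tsum_eq, hy]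
    refine pow_le_pow_left₀ (norm_nonneg _) ((norm_inner_le_norm _ _).trans ?_) 2
    rw [γ.orthonormal.1 n, one_mul]
  · obtain ⟨y, hy, -⟩ := hV.exists_inner_compVec b (φ m) (e k)
    simp only [hy]
    refine hγ.tsum_div_le_one hg (ha k) fun z => ?_
    refine le_trans ?_ (le_hasSum (hΦts z) k fun l _ => mul_nonneg (ha l) (sq_nonneg _))
    refine mul_le_mul_of_nonneg_left ?_ (ha k)
    rw [← hy]
    refine pow_le_pow_left₀ (norm_nonneg _) ((norm_inner_le_norm _ _).trans ?_) 2
    rw [φ.orthonormal.1 m, one_mul]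

end ComplementaryPair

section SpectralData

variable {E : Type*} [NormedAddCommGroup E] [InnerProductSpace ℂ E]

/-- `e` is an orthonormal eigenbasis of the positive trace-class operator `T` with
eigenvalues `a`. -/
structure IsSpectralData (T : E →L[ℂ] E) {s : Set E} (e : HilbertBasis s ℂ E) (a : s → ℝ) :
    Prop where
  coe_eq : ⇑e = ((↑) : s → E)
  isEigenbasis : IsEigenbasis T e a
  nonneg : ∀ k, 0 ≤ a k
  summable : Summable a

variable {T T' : E →L[ℂ] E} {s s' : Set E} {e : HilbertBasis s ℂ E} {e' : HilbertBasis s' ℂ E}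
  {a : s → ℝ} {a' : s' → ℝ} {M ε t : ℝ}

theorem IsSpectralData.tsum_ofReal (h : IsSpectralData T e a) :
    ∑' k, ENNReal.ofReal (a k) = ENNReal.ofReal (∑' k, a k) :=
  (ENNReal.ofReal_tsum_of_nonneg h.nonneg h.summable).symm

theorem IsSpectralData.tsum_nonneg (h : IsSpectralData T e a) : 0 ≤ ∑' k, a k :=
  _root_.tsum_nonneg h.nonneg

theorem IsSpectralData.le_of_tsum_le (h : IsSpectralData T e a) (hM : ∑' k, a k ≤ M) (k : s) :
    a k ≤ M :=
  (h.summable.le_tsum k fun j _ => h.nonneg j).trans hM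

theorem IsSpectralData.cutSum_ne_top (h : IsSpectralData T e a) (hε : 0 < ε) (hM : 0 < M) :
    cutSum M ε a ≠ ∞ :=
  QIT.cutSum_ne_top hε hM h.nonneg (h.tsum_ofReal ▸ ENNReal.ofReal_ne_top)

theorem IsSpectralData.toReal_relSum_eq_add (h : IsSpectralData T e a) (hε : 0 < ε)
    (hεM : ε ≤ M) (hfin : relSum M a ≠ ∞) :
    (relSum M a).toReal = (cutSum M ε a).toReal + (relSum ε a).toReal := by
  rw [relSum_eq_cutSum_add hε hεM h.nonneg, ENNReal.toReal_add]
  · exact h.cutSum_ne_top hε (hε.trans_le hεM)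
  · exact ne_top_of_le_ne_top hfin (relSum_mono hε hεM h.nonneg)

theorem IsSpectralData.tailSum_ne_top (h : IsSpectralData T e a) : tailSum ε a ≠ ∞ := by
  refine ne_top_of_le_ne_top (h.tsum_ofReal ▸ ENNReal.ofReal_ne_top)
    (ENNReal.tsum_le_tsum fun k => ENNReal.ofReal_le_ofReal ?_)
  split_ifs
  · exact le_rfl
  · exact h.nonneg k

theorem IsSpectralData.toReal_tailSum_le (h : IsSpectralData T e a) (hε : 0 < ε)
    (hεM : Real.exp 1 * ε ≤ M) :
    (tailSum ε a).toReal ≤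
      (cutSum M ε a).toReal - (cutSum M (Real.exp 1 * ε) a).toReal := by
  have hM : 0 < M := (mul_pos (Real.exp_pos 1) hε).trans_le hεM
  have hcut := h.cutSum_ne_top (mul_pos (Real.exp_pos 1) hε) hM
  have h1 := ENNReal.toReal_mono (h.cutSum_ne_top hε hM)
    (tailSum_add_cutSum_le hε hεM h.nonneg)
  rw [ENNReal.toReal_add h.tailSum_ne_top hcut] at h1
  exact le_sub_iff_add_le.2 h1

theorem IsSpectralData.tsum_le_add (h : IsSpectralData T e a) (h' : IsSpectralData T' e' a')
    (ht : 0 ≤ t) (hd : ∑' k, ENNReal.ofReal |qf (T - T') (e' k)| ≤ ENNReal.ofReal t) :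
    ∑' k, a k ≤ ∑' k, a' k + t := by
  rw [← ENNReal.ofReal_le_ofReal_iff (add_nonneg h'.tsum_nonneg ht),
    ENNReal.ofReal_add h'.tsum_nonneg ht, ← h.tsum_ofReal, ← h'.tsum_ofReal,
    ← h.isEigenbasis.tsum_ofReal_qf h.nonneg e']
  refine le_trans ?_ (add_le_add le_rfl hd)
  rw [← ENNReal.tsum_add]
  refine ENNReal.tsum_le_tsum fun k => ?_
  rw [← ENNReal.ofReal_add (h'.nonneg k) (abs_nonneg _), qf_sub, h'.isEigenbasis.qf_apply]
  exact ENNReal.ofReal_le_ofReal (by linarith [le_abs_self (qf T (e' k) - a' k)])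

theorem IsSpectralData.toReal_cutSum_le (h : IsSpectralData T e a) (h' : IsSpectralData T' e' a')
    (hX : ∑' k, a k ≤ M) (hX' : ∑' k, a' k ≤ M) (hε : 0 < ε) (hεM : ε ≤ M) (ht : 0 ≤ t)
    (hd : ∑' k, ENNReal.ofReal |qf (T - T') (e' k)| ≤ ENNReal.ofReal t) :
    (cutSum M ε a).toReal ≤ (cutSum M ε a').toReal + (Real.log (M / ε) + 1) * t := by
  have hM : 0 < M := hε.trans_le hεM
  have hL : 0 ≤ Real.log (M / ε) + 1 := by
    linarith [Real.log_nonneg ((one_le_div hε).2 hεM)]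
  have h1 := (h.isEigenbasis.cutSum_le h'.isEigenbasis h.nonneg h'.nonneg (h.le_of_tsum_le hX)
    (h'.le_of_tsum_le hX') hε hεM).trans (add_le_add le_rfl (mul_le_mul_right hd _))
  rw [← ENNReal.ofReal_mul hL] at h1
  have h2 := ENNReal.toReal_mono
    (ENNReal.add_ne_top.2 ⟨h'.cutSum_ne_top hε hM, ENNReal.ofReal_ne_top⟩) h1
  rwa [ENNReal.toReal_add (h'.cutSum_ne_top hε hM) ENNReal.ofReal_ne_top,
    ENNReal.toReal_ofReal (mul_nonneg hL ht)] at h2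

variable [CompleteSpace E]

theorem exists_isSpectralData {T : E →L[ℂ] E} (hT : T ∈ posTC E) :
    ∃ (s : Set E) (e : HilbertBasis s ℂ E) (a : s → ℝ), IsSpectralData T e a := by
  obtain ⟨s, e, a, he, h⟩ := hT.2.exists_isEigenbasis hT.1.isSymmetric
  refine ⟨s, e, a, he, h, fun k => ?_, h.summable hT.2⟩
  rw [← h.qf_apply k]
  exact hT.1.re_inner_nonneg_right (e k)

theorem IsSpectralData.relSum_eq (h : IsSpectralData T e a) (hM : 0 < M)
    (hX : ∑' k, a k ≤ M) :
    relSum M a = qEntropy T + ENNReal.ofReal ((∑' k, a k) * Real.log (M / ∑' k, a k)) := by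
  rw [h.isEigenbasis.qEntropy_eq h.coe_eq h.nonneg h.summable.hasSum]
  exact relSum_eq_add_of_tsum_eq hM h.tsum_nonneg hX h.nonneg h.tsum_ofReal

theorem IsSpectralData.relSum_ne_top_iff (h : IsSpectralData T e a) (hM : 0 < M)
    (hX : ∑' k, a k ≤ M) : relSum M a ≠ ∞ ↔ qEntropy T ≠ ∞ := by
  rw [h.relSum_eq hM hX]
  simp

theorem IsSpectralData.toReal_relSum (h : IsSpectralData T e a) (hM : 0 < M)
    (hX : ∑' k, a k ≤ M) (hfin : qEntropy T ≠ ∞) :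
    (relSum M a).toReal = (qEntropy T).toReal + (∑' k, a k) * Real.log (M / ∑' k, a k) := by
  rw [h.relSum_eq hM hX, ENNReal.toReal_add hfin ENNReal.ofReal_ne_top, ENNReal.toReal_ofReal]
  rcases h.tsum_nonneg.eq_or_lt with h0 | h0
  · simp [← h0]
  · exact mul_nonneg h0.le (Real.log_nonneg ((one_le_div h0).2 hX))

end SpectralData

section Pair

variable {E F G : Type*}
variable [NormedAddCommGroup E] [InnerProductSpace ℂ E] [CompleteSpace E]
variable [NormedAddCommGroup F] [InnerProductSpace ℂ F] [CompleteSpace F]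
variable [NormedAddCommGroup G] [InnerProductSpace ℂ G] [CompleteSpace G]
variable {Φ : TraceMap E F} {Φt : TraceMap E G} {A : E →L[ℂ] E}
variable {r : Set E} {e : HilbertBasis r ℂ E} {a : r → ℝ}
variable {s : Set F} {φ : HilbertBasis s ℂ F} {f : s → ℝ}
variable {u : Set G} {γ : HilbertBasis u ℂ G} {g : u → ℝ}

theorem TraceMap.map_mem_posTC (Φ : TraceMap E F) (hA : A ∈ posTC E) : Φ.toFun A ∈ posTC F :=
  ⟨Φ.pos A hA.2 hA.1, Φ.maps_tc A hA.2⟩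

theorem IsComplementaryPair.tsum_eq_and_le (hc : IsComplementaryPair Φ Φt) (hA : A ∈ posTC E)
    (ha : IsSpectralData A e a) (hf : IsSpectralData (Φ.toFun A) φ f)
    (hg : IsSpectralData (Φt.toFun A) γ g) :
    ∑' m, f m = ∑' n, g n ∧ ∑' n, g n ≤ ∑' k, a k := by
  obtain ⟨w, hwf, hwg, hwa, -, -⟩ := hc.exists_coupling hA.2 ha.isEigenbasis ha.nonneg
    hf.isEigenbasis hf.nonneg hg.isEigenbasis hg.nonneg
  have h1 : ∑' m, ENNReal.ofReal (f m) = ∑' k, ∑' m, ∑' n, w k m n := by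
    rw [ENNReal.tsum_comm]
    exact tsum_congr fun m => (hwf m).symm
  have h2 : ∑' n, ENNReal.ofReal (g n) = ∑' k, ∑' m, ∑' n, w k m n := by
    rw [tsum_congr fun n => (hwg n).symm, ENNReal.tsum_comm]
    exact tsum_congr fun k => ENNReal.tsum_comm
  constructor
  · rw [← ENNReal.ofReal_eq_ofReal_iff hf.tsum_nonneg hg.tsum_nonneg, ← hf.tsum_ofReal,
      ← hg.tsum_ofReal, h1, h2]
  · rw [← ENNReal.ofReal_le_ofReal_iff ha.tsum_nonneg, ← hg.tsum_ofReal, ← ha.tsum_ofReal, h2]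
    exact ENNReal.tsum_le_tsum hwa

theorem IsComplementaryPair.relSum_le_and_le (hc : IsComplementaryPair Φ Φt) (hA : A ∈ posTC E)
    (ha : IsSpectralData A e a) (hf : IsSpectralData (Φ.toFun A) φ f)
    (hg : IsSpectralData (Φt.toFun A) γ g) {δ ε K M : ℝ} (hδ : 0 < δ) (hδK : δ ≤ K) (hε : 0 < ε)
    (hM : ∑' k, a k ≤ M) :
    relSum ε f ≤ relSum ε g + ENNReal.ofReal (M * M / K) + relSum δ a +
        ENNReal.ofReal (Real.log (K / δ)) * tailSum ε f ∧
      relSum ε g ≤ relSum ε f + ENNReal.ofReal (M * M / K) + relSum δ a +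
        ENNReal.ofReal (Real.log (K / δ)) * tailSum ε g := by
  have hM0 : 0 ≤ M := ha.tsum_nonneg.trans hM
  obtain ⟨hfg, hga⟩ := hc.tsum_eq_and_le hA ha hf hg
  obtain ⟨w, hwf, hwg, hwa, hw1, hw2⟩ := hc.exists_coupling hA.2 ha.isEigenbasis ha.nonneg
    hf.isEigenbasis hf.nonneg hg.isEigenbasis hg.nonneg
  have hK : 0 < K := hδ.trans_le hδK
  have hMM : ∀ x y : ℝ, x ≤ M → y ≤ M →
      ENNReal.ofReal x * ENNReal.ofReal y / ENNReal.ofReal K ≤ ENNReal.ofReal (M * M / K) := by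
    intro x y hx hy
    rw [ENNReal.ofReal_div_of_pos hK, ENNReal.ofReal_mul hM0]
    gcongr
  have h1 := relSum_le_of_coupling ha.nonneg hf.nonneg hg.nonneg hwf hwg hwa hw1 hδ hδK hε
  have h2 := relSum_le_of_coupling (w := fun k n m => w k m n) ha.nonneg hg.nonneg hf.nonneg
    hwg hwf (fun k => ENNReal.tsum_comm.trans_le (hwa k)) hw2 hδ hδK hε
  rw [hg.tsum_ofReal, ha.tsum_ofReal] at h1
  rw [hf.tsum_ofReal, ha.tsum_ofReal] at h2
  exact ⟨h1.trans (by gcongr; exact hMM _ _ (hga.trans hM) hM),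
    h2.trans (by gcongr; exact hMM _ _ (hfg.trans_le (hga.trans hM)) hM)⟩

theorem IsComplementaryPair.outEntropy_ne_top (hc : IsComplementaryPair Φ Φt)
    (hA : A ∈ posTC E) (hent : qEntropy A ≠ ∞)
    (hmin : outEntropy Φ A ≠ ∞ ∨ outEntropy Φt A ≠ ∞) :
    outEntropy Φ A ≠ ∞ ∧ outEntropy Φt A ≠ ∞ := by
  obtain ⟨r, e, a, ha⟩ := exists_isSpectralData hA
  obtain ⟨s, φ, f, hf⟩ := exists_isSpectralData (Φ.map_mem_posTC hA)
  obtain ⟨u, γ, g, hg⟩ := exists_isSpectralData (Φt.map_mem_posTC hA)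
  obtain ⟨hfg, hga⟩ := hc.tsum_eq_and_le hA ha hf hg
  set M := ∑' k, a k + 1 with hMdef
  have haM : ∑' k, a k ≤ M := by linarith
  have hM : 0 < M := by linarith [ha.tsum_nonneg]
  obtain ⟨h1, h2⟩ := hc.relSum_le_and_le hA ha hf hg hM le_rfl hM haM
  rw [div_self hM.ne', Real.log_one, ENNReal.ofReal_zero, zero_mul, add_zero] at h1 h2
  have ha' := (ha.relSum_ne_top_iff hM haM).2 hent
  unfold outEntropy at *
  rw [← hf.relSum_ne_top_iff hM (hfg.trans_le (hga.trans haM)),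
    ← hg.relSum_ne_top_iff hM (hga.trans haM)] at *
  rcases hmin with h | h
  · exact ⟨h, ne_top_of_le_ne_top (ENNReal.add_ne_top.2
      ⟨ENNReal.add_ne_top.2 ⟨h, ENNReal.ofReal_ne_top⟩, ha'⟩) h2⟩
  · exact ⟨ne_top_of_le_ne_top (ENNReal.add_ne_top.2
      ⟨ENNReal.add_ne_top.2 ⟨h, ENNReal.ofReal_ne_top⟩, ha'⟩) h1, h⟩

theorem toReal_le_toReal_add {x y p q : ℝ≥0∞} {P L : ℝ} (hP : 0 ≤ P) (hL : 0 ≤ L) (hy : y ≠ ∞)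
    (hp : p ≠ ∞) (hq : q ≠ ∞) (h : x ≤ y + ENNReal.ofReal P + p + ENNReal.ofReal L * q) :
    x.toReal ≤ y.toReal + P + p.toReal + L * q.toReal := by
  lift y to ℝ≥0 using hy
  lift p to ℝ≥0 using hp
  lift q to ℝ≥0 using hq
  lift P to ℝ≥0 using hP
  lift L to ℝ≥0 using hL
  simp only [ENNReal.ofReal_coe_nnreal] at h
  norm_cast at h
  lift x to ℝ≥0 using ne_top_of_le_ne_top ENNReal.coe_ne_top h
  simp only [ENNReal.coe_toReal]
  exact_mod_cast h

theorem IsComplementaryPair.abs_relSum_sub_le (hc : IsComplementaryPair Φ Φt) (hA : A ∈ posTC E)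
    (ha : IsSpectralData A e a) (hf : IsSpectralData (Φ.toFun A) φ f)
    (hg : IsSpectralData (Φt.toFun A) γ g) {δ ε K M : ℝ} (hδ : 0 < δ) (hδK : δ ≤ K) (hε : 0 < ε)
    (hM : ∑' k, a k ≤ M) (hfin : relSum δ a ≠ ∞) (hffin : relSum ε f ≠ ∞)
    (hgfin : relSum ε g ≠ ∞) :
    |(relSum ε f).toReal - (relSum ε g).toReal| ≤ M * M / K + (relSum δ a).toReal +
      Real.log (K / δ) * ((tailSum ε f).toReal + (tailSum ε g).toReal) := by
  obtain ⟨h1, h2⟩ := hc.relSum_le_and_le hA ha hf hg hδ hδK hε hM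
  have hK : 0 < K := hδ.trans_le hδK
  have hL : 0 ≤ Real.log (K / δ) := Real.log_nonneg ((one_le_div hδ).2 hδK)
  have hP : 0 ≤ M * M / K := div_nonneg (mul_self_nonneg M) hK.le
  have h1' := toReal_le_toReal_add hP hL hgfin hfin hf.tailSum_ne_top h1
  have h2' := toReal_le_toReal_add hP hL hffin hfin hg.tailSum_ne_top h2
  have h3 := mul_nonneg hL (ENNReal.toReal_nonneg (a := tailSum ε f))
  have h4 := mul_nonneg hL (ENNReal.toReal_nonneg (a := tailSum ε g))
  rw [mul_add, abs_le]
  constructor <;> linarith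

theorem IsComplementaryPair.toReal_outEntropy_sub (hc : IsComplementaryPair Φ Φt)
    (hA : A ∈ posTC E) (ha : IsSpectralData A e a) (hf : IsSpectralData (Φ.toFun A) φ f)
    (hg : IsSpectralData (Φt.toFun A) γ g) {ε M : ℝ} (hε : 0 < ε) (hεM : ε ≤ M)
    (hM : ∑' k, a k ≤ M) (hffin : outEntropy Φ A ≠ ∞) (hgfin : outEntropy Φt A ≠ ∞) :
    (outEntropy Φ A).toReal - (outEntropy Φt A).toReal =
      ((cutSum M ε f).toReal - (cutSum M ε g).toReal) +
        ((relSum ε f).toReal - (relSum ε g).toReal) := by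
  obtain ⟨hfg, hga⟩ := hc.tsum_eq_and_le hA ha hf hg
  have hM0 : 0 < M := hε.trans_le hεM
  have hgM := hga.trans hM
  have hfM := hfg.trans_le hgM
  have h1 := hf.toReal_relSum hM0 hfM hffin
  have h2 := hg.toReal_relSum hM0 hgM hgfin
  rw [hf.toReal_relSum_eq_add hε hεM ((hf.relSum_ne_top_iff hM0 hfM).2 hffin), hfg] at h1
  rw [hg.toReal_relSum_eq_add hε hεM ((hg.relSum_ne_top_iff hM0 hgM).2 hgfin)] at h2
  unfold outEntropy
  linarith

end Pair

section Continuity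

variable {E F G : Type*}
variable [NormedAddCommGroup E] [InnerProductSpace ℂ E]
variable [NormedAddCommGroup F] [InnerProductSpace ℂ F]
variable [NormedAddCommGroup G] [InnerProductSpace ℂ G]

/-- In every orthonormal basis the diagonals of `T` and `T'` are at `ℓ¹` distance at most `t`. -/
def DiagClose (t : ℝ) (T T' : E →L[ℂ] E) : Prop :=
  ∀ (s : Set E) (b : HilbertBasis s ℂ E),
    ∑' k, ENNReal.ofReal |qf (T - T') (b k)| ≤ ENNReal.ofReal t

theorem DiagClose.symm {t : ℝ} {T T' : E →L[ℂ] E} (h : DiagClose t T T') : DiagClose t T' T := by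
  intro s b
  simpa only [qf_sub, abs_sub_comm] using h s b

theorem DiagClose.refl (T : E →L[ℂ] E) : DiagClose 0 T T := by
  intro s b
  simp [qf]

section Operators

variable {T T' : E →L[ℂ] E} {s s' : Set E} {e : HilbertBasis s ℂ E} {e' : HilbertBasis s' ℂ E}
  {a : s → ℝ} {a' : s' → ℝ} {M ε t : ℝ}

theorem DiagClose.abs_toReal_cutSum_sub_le (hd : DiagClose t T T') (h : IsSpectralData T e a)
    (h' : IsSpectralData T' e' a') (hX : ∑' k, a k ≤ M) (hX' : ∑' k, a' k ≤ M) (hε : 0 < ε)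
    (hεM : ε ≤ M) (ht : 0 ≤ t) :
    |(cutSum M ε a).toReal - (cutSum M ε a').toReal| ≤ (Real.log (M / ε) + 1) * t := by
  have h1 := h.toReal_cutSum_le h' hX hX' hε hεM ht (hd _ _)
  have h2 := h'.toReal_cutSum_le h hX' hX hε hεM ht (hd.symm _ _)
  rw [abs_le]
  constructor <;> linarith

theorem DiagClose.abs_tsum_sub_le (hd : DiagClose t T T') (h : IsSpectralData T e a)
    (h' : IsSpectralData T' e' a') (ht : 0 ≤ t) : |∑' k, a k - ∑' k, a' k| ≤ t := by
  have h1 := h.tsum_le_add h' ht (hd _ _)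
  have h2 := h'.tsum_le_add h ht (hd.symm _ _)
  rw [abs_le]
  constructor <;> linarith

theorem DiagClose.toReal_tailSum_le (hd : DiagClose t T T') (h : IsSpectralData T e a)
    (h' : IsSpectralData T' e' a') (hX : ∑' k, a k ≤ M) (hX' : ∑' k, a' k ≤ M) (hε : 0 < ε)
    (hεM : Real.exp 1 * ε ≤ M) (ht : 0 ≤ t) (hfin : relSum M a' ≠ ∞) :
    (tailSum ε a).toReal ≤ (relSum (Real.exp 1 * ε) a').toReal +
      ((Real.log (M / ε) + 1) + (Real.log (M / (Real.exp 1 * ε)) + 1)) * t := by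
  have he : ε ≤ Real.exp 1 * ε := le_mul_of_one_le_left hε.le (Real.one_le_exp zero_le_one)
  have h1 := h.toReal_tailSum_le hε hεM
  have h2 := abs_le.1 (hd.abs_toReal_cutSum_sub_le h h' hX hX' hε (he.trans hεM) ht)
  have h3 := abs_le.1 (hd.abs_toReal_cutSum_sub_le h h' hX hX' (hε.trans_le he) hεM ht)
  have h4 := h'.toReal_relSum_eq_add hε (he.trans hεM) hfin
  have h5 := h'.toReal_relSum_eq_add (hε.trans_le he) hεM hfin
  have h6 := ENNReal.toReal_nonneg (a := relSum ε a')
  rw [add_mul]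
  linarith [h2.2, h3.1]

theorem DiagClose.toReal_relSum_le [CompleteSpace E] (hd : DiagClose t T T')
    (h : IsSpectralData T e a) (h' : IsSpectralData T' e' a') (hX : ∑' k, a k ≤ M)
    (hX' : ∑' k, a' k ≤ M) (hε : 0 < ε) (hεM : ε ≤ M) (ht : 0 ≤ t)
    (hfin : qEntropy T ≠ ∞) (hfin' : qEntropy T' ≠ ∞) :
    (relSum ε a).toReal ≤ (relSum ε a').toReal + |(qEntropy T).toReal - (qEntropy T').toReal| +
      |(∑' k, a k) * Real.log (M / ∑' k, a k) - (∑' k, a' k) * Real.log (M / ∑' k, a' k)| +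
      (Real.log (M / ε) + 1) * t := by
  have hM : 0 < M := hε.trans_le hεM
  have h1 := h.toReal_relSum hM hX hfin
  have h2 := h'.toReal_relSum hM hX' hfin'
  rw [h.toReal_relSum_eq_add hε hεM ((h.relSum_ne_top_iff hM hX).2 hfin)] at h1
  rw [h'.toReal_relSum_eq_add hε hεM ((h'.relSum_ne_top_iff hM hX').2 hfin')] at h2
  have h3 := abs_le.1 (hd.abs_toReal_cutSum_sub_le h h' hX hX' hε hεM ht)
  linarith [h3.1, le_abs_self ((qEntropy T).toReal - (qEntropy T').toReal), le_abs_self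
    ((∑' k, a k) * Real.log (M / ∑' k, a k) - (∑' k, a' k) * Real.log (M / ∑' k, a' k))]

end Operators

theorem diagClose_of_traceNorm_lt {t : ℝ} {A B : E →L[ℂ] E}
    (h : traceNorm (B - A) < ENNReal.ofReal t) : DiagClose t B A :=
  fun _ b => (tsum_ofReal_abs_qf_le _ b).trans h.le

variable [CompleteSpace E] [CompleteSpace F] [CompleteSpace G]
variable {Φ : TraceMap E F} {Φt : TraceMap E G}

theorem TraceMap.map_sub (Φ : TraceMap E F) {A B : E →L[ℂ] E} (hA : IsTC A)
    (hBA : IsTC (B - A)) : Φ.toFun (B - A) = Φ.toFun B - Φ.toFun A := by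
  rw [eq_sub_iff_add_eq, ← Φ.map_add _ _ hBA hA, sub_add_cancel]

theorem IsComplementaryPair.diagClose (hc : IsComplementaryPair Φ Φt) {t : ℝ}
    {A B : E →L[ℂ] E} (hA : A ∈ posTC E) (hB : B ∈ posTC E)
    (h : traceNorm (B - A) < ENNReal.ofReal t) :
    DiagClose t (Φ.toFun B) (Φ.toFun A) ∧ DiagClose t (Φt.toFun B) (Φt.toFun A) := by
  have hBA : IsTC (B - A) := h.ne_top
  have hsymm : ((B - A : E →L[ℂ] E) : E →ₗ[ℂ] E).IsSymmetric :=
    hB.1.isSymmetric.sub hA.1.isSymmetric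
  refine ⟨fun _ b => ?_, fun _ b => ?_⟩
  · rw [← Φ.map_sub hA.2 hBA]
    exact (hc.tsum_abs_qf_le hBA hsymm b).trans h.le
  · rw [← Φt.map_sub hA.2 hBA]
    exact (hc.tsum_abs_qf_le' hBA hsymm b).trans h.le

theorem continuous_mul_log_div {M : ℝ} (hM : 0 < M) :
    Continuous fun x : ℝ => x * Real.log (M / x) := by
  have : (fun x : ℝ => x * Real.log (M / x)) = fun x => x * Real.log M + Real.negMulLog x := by
    ext x
    rcases eq_or_ne x 0 with rfl | hx
    · simp
    · rw [Real.log_div hM.ne' hx, Real.negMulLog]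
      ring
  rw [this]
  fun_prop

theorem exists_relSum_toReal_lt {ι : Type*} {M N η : ℝ} {x : ι → ℝ} (hM : 0 < M) (hN : 0 < N)
    (hη : 0 < η) (hx : ∀ i, 0 ≤ x i) (hs : relSum M x ≠ ∞) :
    ∃ ε, 0 < ε ∧ ε ≤ M ∧ ε ≤ N ∧
      ∀ ε', 0 < ε' → ε' ≤ ε → relSum ε' x ≠ ∞ ∧ (relSum ε' x).toReal < η := by
  obtain ⟨ε, hε, hεM, h⟩ := exists_relSum_lt hM hx hs (ENNReal.ofReal_pos.2 hη).ne'
  refine ⟨min ε N, lt_min hε hN, (min_le_left _ _).trans hεM, min_le_right _ _,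
    fun ε' h0 h1 => ?_⟩
  have h2 := (relSum_mono h0 (h1.trans (min_le_left _ _)) hx).trans_lt h
  exact ⟨h2.ne_top, (ENNReal.lt_ofReal_iff_toReal_lt h2.ne_top).1 h2⟩

theorem IsComplementaryPair.rContOn_outEntropy_sub (hc : IsComplementaryPair Φ Φt)
    {𝒜 : Set (E →L[ℂ] E)} (h𝒜 : 𝒜 ⊆ posTC E) (hent : ContOn qEntropy 𝒜)
    (hfin : ∀ A ∈ 𝒜, outEntropy Φ A ≠ ∞ ∧ outEntropy Φt A ≠ ∞) :
    RContOn (fun A => (outEntropy Φ A).toReal - (outEntropy Φt A).toReal) 𝒜 := by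
  intro A hA η' hη'
  obtain ⟨r, e, a, ha⟩ := exists_isSpectralData (h𝒜 hA)
  obtain ⟨s, φ, f, hf⟩ := exists_isSpectralData (Φ.map_mem_posTC (h𝒜 hA))
  obtain ⟨u, γ, g, hg⟩ := exists_isSpectralData (Φt.map_mem_posTC (h𝒜 hA))
  obtain ⟨hfg, hga⟩ := hc.tsum_eq_and_le (h𝒜 hA) ha hf hg
  obtain ⟨hff, hgf⟩ := hfin A hA
  obtain ⟨M, hMdef⟩ : ∃ M, M = ∑' k, a k + 1 := ⟨_, rfl⟩
  have haM : ∑' k, a k ≤ M := by linarith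
  have hgM := hga.trans haM
  have hfM := hfg.trans_le hgM
  have hM : 0 < M := by linarith [ha.tsum_nonneg]
  have haR := (ha.relSum_ne_top_iff hM haM).2 (hent.1 A hA)
  have hfR := (hf.relSum_ne_top_iff hM hfM).2 hff
  have hgR := (hg.relSum_ne_top_iff hM hgM).2 hgf
  obtain ⟨η, hη, hηη'⟩ : ∃ η, 0 < η ∧ 16 * η = η' := ⟨η' / 16, by positivity, by ring⟩
  obtain ⟨K, hK, hMK⟩ : ∃ K, 0 < K ∧ M * M / K = η :=
    ⟨M * M / η, by positivity, by field_simp⟩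
  obtain ⟨δ, hδ, hδM, hδK, hδa⟩ := exists_relSum_toReal_lt hM hK hη ha.nonneg haR
  obtain ⟨hδtop, hδa⟩ := hδa δ hδ le_rfl
  obtain ⟨Λ, hΛdef⟩ : ∃ Λ, Λ = Real.log (K / δ) := ⟨_, rfl⟩
  have hΛ : 0 ≤ Λ := hΛdef ▸ Real.log_nonneg ((one_le_div hδ).2 hδK)
  have hηΛ : 0 < η / (Λ + 1) := by positivity
  have hΛη : Λ * (η / (Λ + 1)) ≤ η := by
    rw [mul_div_assoc', div_le_iff₀ (by positivity)]
    nlinarith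
  obtain ⟨ε₁, hε₁, hε₁M, -, hε₁f⟩ := exists_relSum_toReal_lt hM hM hηΛ hf.nonneg hfR
  obtain ⟨ε₂, hε₂, -, hε₂₁, hε₂g⟩ := exists_relSum_toReal_lt hM hε₁ hηΛ hg.nonneg hgR
  obtain ⟨ε, hε, hεe⟩ : ∃ ε, 0 < ε ∧ Real.exp 1 * ε = ε₂ :=
    ⟨ε₂ / Real.exp 1, by positivity, by field_simp⟩
  have hεε₂ : ε ≤ ε₂ := hεe ▸ le_mul_of_one_le_left hε.le (Real.one_le_exp zero_le_one)
  have hε₂M : Real.exp 1 * ε ≤ M := hεe ▸ hε₂₁.trans hε₁M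
  have hεM : ε ≤ M := hεε₂.trans (hε₂₁.trans hε₁M)
  have hfe := (hε₁f _ (by positivity) (hεe.trans_le hε₂₁)).2
  have hge := (hε₂g _ (by positivity) hεe.le).2
  have hL : ∀ {x : ℝ}, 0 < x → x ≤ M → 0 < Real.log (M / x) + 1 := fun h0 h1 => by
    linarith [Real.log_nonneg ((one_le_div h0).2 h1)]
  obtain ⟨Lδ, hLδ⟩ : ∃ L, L = Real.log (M / δ) + 1 := ⟨_, rfl⟩
  obtain ⟨Lε, hLε⟩ : ∃ L, L = Real.log (M / ε) + 1 := ⟨_, rfl⟩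
  obtain ⟨Lε', hLε'⟩ : ∃ L, L = Real.log (M / (Real.exp 1 * ε)) + 1 := ⟨_, rfl⟩
  have hLδ0 : 0 < Lδ := hLδ ▸ hL hδ hδM
  have hLε0 : 0 < Lε := hLε ▸ hL hε hεM
  have hLε'0 : 0 < Lε' := hLε' ▸ hL (by positivity) hε₂M
  obtain ⟨t₁, ht₁, hH⟩ := hent.2 A hA η hη
  obtain ⟨t₂, ht₂, hψ⟩ := Metric.continuous_iff.1 (continuous_mul_log_div hM) (∑' k, a k) η hη
  have hsmall : ∀ᶠ t in 𝓝[>] (0 : ℝ), 0 < t ∧ t < t₁ ∧ t < t₂ ∧ t < 1 ∧ t < η / Lδ ∧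
      t < η / Lε ∧ t < η / (Λ + 1) / (Lε + Lε') := by
    have hev : ∀ {c : ℝ}, 0 < c → ∀ᶠ t in 𝓝[>] (0 : ℝ), t < c := fun hc =>
      nhdsWithin_le_nhds (Iio_mem_nhds hc)
    exact eventually_mem_nhdsWithin.and ((hev ht₁).and ((hev ht₂).and ((hev one_pos).and
      ((hev (by positivity)).and ((hev (by positivity)).and (hev (by positivity)))))))
  obtain ⟨t, ht, htt₁, htt₂, ht1, htδ, htε, htε'⟩ := hsmall.exists
  rw [lt_div_iff₀' (by positivity)] at htδ htε htε'
  refine ⟨t, ht, fun B hB hBA => ?_⟩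
  obtain ⟨r', e', b, hb⟩ := exists_isSpectralData (h𝒜 hB)
  obtain ⟨s', φ', p, hp⟩ := exists_isSpectralData (Φ.map_mem_posTC (h𝒜 hB))
  obtain ⟨u', γ', q, hq⟩ := exists_isSpectralData (Φt.map_mem_posTC (h𝒜 hB))
  obtain ⟨hpq, hqb⟩ := hc.tsum_eq_and_le (h𝒜 hB) hb hp hq
  obtain ⟨hpf, hqf⟩ := hfin B hB
  have hd := diagClose_of_traceNorm_lt hBA
  obtain ⟨hdp, hdq⟩ := hc.diagClose (h𝒜 hA) (h𝒜 hB) hBA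
  have hX := hd.abs_tsum_sub_le hb ha ht.le
  have hbM : ∑' k, b k ≤ M := by linarith [(abs_le.1 hX).2]
  have hqM := hqb.trans hbM
  have hpM := hpq.trans_le hqM
  have hpR := (hp.relSum_ne_top_iff hM hpM).2 hpf
  have hqR := (hq.relSum_ne_top_iff hM hqM).2 hqf
  have hbR := (hb.relSum_ne_top_iff hM hbM).2 (hent.1 B hB)
  have hcutf := hdp.abs_toReal_cutSum_sub_le hp hf hpM hfM hε hεM ht.le
  have hcutg := hdq.abs_toReal_cutSum_sub_le hq hg hqM hgM hε hεM ht.le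
  have htp := hdp.toReal_tailSum_le hp hf hpM hfM hε hε₂M ht.le hfR
  have htq := hdq.toReal_tailSum_le hq hg hqM hgM hε hε₂M ht.le hgR
  have htf := (DiagClose.refl _).toReal_tailSum_le hf hf hfM hfM hε hε₂M le_rfl hfR
  have htg := (DiagClose.refl _).toReal_tailSum_le hg hg hgM hgM hε hε₂M le_rfl hgR
  have hrel := hd.toReal_relSum_le hb ha hbM haM hδ hδM ht.le (hent.1 B hB) (hent.1 A hA)
  have hHB := hH B hB (hBA.trans_le (ENNReal.ofReal_le_ofReal htt₁.le))
  have hψB := hψ (∑' k, b k) (hX.trans_lt htt₂)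
  rw [Real.dist_eq] at hψB
  have hDA := hc.abs_relSum_sub_le (h𝒜 hA) ha hf hg hδ hδK hε haM hδtop
    (ne_top_of_le_ne_top hfR (relSum_mono hε hεM hf.nonneg))
    (ne_top_of_le_ne_top hgR (relSum_mono hε hεM hg.nonneg))
  have hDB := hc.abs_relSum_sub_le (h𝒜 hB) hb hp hq hδ hδK hε hbM
    (ne_top_of_le_ne_top hbR (relSum_mono hδ hδM hb.nonneg))
    (ne_top_of_le_ne_top hpR (relSum_mono hε hεM hp.nonneg))
    (ne_top_of_le_ne_top hqR (relSum_mono hε hεM hq.nonneg))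
  rw [hMK, ← hΛdef] at hDA hDB
  rw [← hLε] at hcutf hcutg
  rw [← hLδ] at hrel
  rw [← hLε, ← hLε'] at htp htq
  rw [mul_zero, add_zero] at htf htg
  have hΛA := mul_le_mul_of_nonneg_left (show (tailSum ε f).toReal + (tailSum ε g).toReal ≤
    2 * (η / (Λ + 1)) by linarith) hΛ
  have hΛB := mul_le_mul_of_nonneg_left (show (tailSum ε p).toReal + (tailSum ε q).toReal ≤
    4 * (η / (Λ + 1)) by linarith) hΛ
  dsimp only
  rw [hc.toReal_outEntropy_sub (h𝒜 hA) ha hf hg hε hεM haM hff hgf,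
    hc.toReal_outEntropy_sub (h𝒜 hB) hb hp hq hε hεM hbM hpf hqf]
  rw [abs_le] at hcutf hcutg hDA hDB
  rw [abs_lt]
  constructor <;> linarith [hcutf.1, hcutf.2, hcutg.1, hcutg.2, hDA.1, hDA.2, hDB.1, hDB.2]

end Continuity

/-- Proposition 7 of the paper. Let `Φ` be a quantum operation with
complementary operation `Φt`, and `𝒜 ⊆ 𝔗₊(ℋ)` with `min{H_Φ(A), H_Φt(A)} < ∞` on `𝒜`.
If the quantum entropy is continuous on `𝒜`, then both output entropies are finite on
`𝒜` and the function `A ↦ H_Φ(A) − H_Φt(A)` is continuous on `𝒜`. -/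
theorem statement14
    {E F G : Type*}
    [NormedAddCommGroup E] [InnerProductSpace ℂ E] [CompleteSpace E]
    [TopologicalSpace.SeparableSpace E]
    [NormedAddCommGroup F] [InnerProductSpace ℂ F] [CompleteSpace F]
    [TopologicalSpace.SeparableSpace F]
    [NormedAddCommGroup G] [InnerProductSpace ℂ G] [CompleteSpace G]
    (Φ : TraceMap E F) (Φt : TraceMap E G) (hc : IsComplementaryPair Φ Φt)
    (𝒜 : Set (E →L[ℂ] E)) (h𝒜 : 𝒜 ⊆ posTC E)
    (hmin : ∀ A ∈ 𝒜, outEntropy Φ A ≠ ∞ ∨ outEntropy Φt A ≠ ∞)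
    (hent : ContOn qEntropy 𝒜) :
    (∀ A ∈ 𝒜, outEntropy Φ A ≠ ∞ ∧ outEntropy Φt A ≠ ∞) ∧
      RContOn (fun A => (outEntropy Φ A).toReal - (outEntropy Φt A).toReal) 𝒜 := by
  have hfin : ∀ A ∈ 𝒜, outEntropy Φ A ≠ ∞ ∧ outEntropy Φt A ≠ ∞ := fun A hA =>
    hc.outEntropy_ne_top (h𝒜 hA) (hent.1 A hA) (hmin A hA)
  exact ⟨hfin, hc.rContOn_outEntropy_sub h𝒜 hent hfin⟩

end QIT
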